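/- arXiv:math/0511698 — 3 statements merged into one kernel-verified Lean document; each statement's English description precedes it below -/
import Mathlib

section
/- Let n,m ≥ 1 and 1 ≤ i ≤ n. For all σ ∈ S_n, τ ∈ S_m and ρ ∈ S_{n+m−1}, one has P_i(ρ) = (σ,τ) if and only if B_i(σ,τ) ≤ ρ ≤ T_i(σ,τ) in the left weak order on S_{n+m−1}. In other words, each fiber of P_i over (σ,τ) is exactly the weak-order interval [B_i(σ,τ), T_i(σ,τ)]. -/
open Equiv

/-- The one-line value (0-indexed) of a permutation of `Fin N`, extended to all of `ℕ`
by the identity.  Position `j` (0-indexed) carries the value `pv σ j` (0-indexed). -/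
def pv {N : ℕ} (σ : Equiv.Perm (Fin N)) (j : ℕ) : ℕ :=
  if h : j < N then (σ ⟨j, h⟩ : ℕ) else j

/-- The left weak (Bruhat) order on `S_N`: inclusion of inversion sets, where the
inversion set of `σ` is `{(p,q) | p < q ∧ σ p > σ q}`. -/
def wle {N : ℕ} (σ τ : Equiv.Perm (Fin N)) : Prop :=
  ∀ p q : Fin N, p < q → σ q < σ p → τ q < τ p

instance {N : ℕ} (σ τ : Equiv.Perm (Fin N)) : Decidable (wle σ τ) :=
  inferInstanceAs (Decidable (∀ p q : Fin N, p < q → σ q < σ p → τ q < τ p))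

/-- The `a`-values of the insertion construction `B_i` (0-indexed values):
`avv m s x = x` if `x < s` and `x + m - 1` otherwise. -/
def avv (m s x : ℕ) : ℕ := if x < s then x else x + m - 1

/-- The one-line values of the permutation `B_i(σ,τ) ∈ S_{n+m-1}`
(0-indexed position `i`, with `i < n`, and 0-indexed values). -/
def BFun {n m : ℕ} (i : ℕ) (σ : Equiv.Perm (Fin n)) (τ : Equiv.Perm (Fin m)) (j : ℕ) : ℕ :=
  if j < i then avv m (pv σ i) (pv σ j)
  else if j < i + m then pv τ (j - i) + pv σ i
  else avv m (pv σ i) (pv σ (j - m + 1))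

/-- `ρ ∈ S_{n+m-1}` is the permutation `B_i(σ,τ)`. -/
def IsB {n m : ℕ} (i : ℕ) (σ : Equiv.Perm (Fin n)) (τ : Equiv.Perm (Fin m))
    (ρ : Equiv.Perm (Fin (n + m - 1))) : Prop :=
  ∀ j : ℕ, j < n + m - 1 → pv ρ j = BFun i σ τ j

/-- The set of entries of the first block `L₁` of `B_i(σ,τ)` (positions `< i`, 0-indexed). -/
def bL1 {n m : ℕ} (i : ℕ) (σ : Equiv.Perm (Fin n)) (τ : Equiv.Perm (Fin m)) : Set ℕ :=
  BFun i σ τ '' {p | p < i}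

/-- The set of entries of the third block `L₃` of `B_i(σ,τ)`
(positions in `[i+m, n+m-2]`, 0-indexed). -/
def bL3 {n m : ℕ} (i : ℕ) (σ : Equiv.Perm (Fin n)) (τ : Equiv.Perm (Fin m)) : Set ℕ :=
  BFun i σ τ '' {p | i + m ≤ p ∧ p < n + m - 1}

/-- The number `k_σ`: the largest `j ≤ i` such that the interval `[σ_i - j, σ_i]`
(of actual integers, whence also `j ≤ σ_i`) is contained in `{L₁} ∪ {σ_i}`. -/
noncomputable def kpar {n m : ℕ} (i : ℕ) (σ : Equiv.Perm (Fin n)) (τ : Equiv.Perm (Fin m)) : ℕ :=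
  sSup {j | j ≤ i ∧ j ≤ pv σ i ∧
    Set.Icc (pv σ i - j) (pv σ i) ⊆ insert (pv σ i) (bL1 i σ τ)}

/-- The number `l_σ`: the largest `j ≤ n - 1 - i` such that `[η, η + j] ⊆ {η} ∪ {L₃}`,
where `η = σ_i + m - 1`. -/
noncomputable def lpar {n m : ℕ} (i : ℕ) (σ : Equiv.Perm (Fin n)) (τ : Equiv.Perm (Fin m)) : ℕ :=
  sSup {j | j ≤ n - 1 - i ∧
    Set.Icc (pv σ i + m - 1) (pv σ i + m - 1 + j) ⊆ insert (pv σ i + m - 1) (bL3 i σ τ)}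

/-- `A_{1,b}`: the entries of `L₁` smaller than `σ_i - k_σ`. -/
noncomputable def A1b {n m : ℕ} (i : ℕ) (σ : Equiv.Perm (Fin n)) (τ : Equiv.Perm (Fin m)) :
    Set ℕ := {x ∈ bL1 i σ τ | x < pv σ i - kpar i σ τ}

/-- `A_{1,t}`: the entries of `L₁` bigger than `σ_i`. -/
def A1t {n m : ℕ} (i : ℕ) (σ : Equiv.Perm (Fin n)) (τ : Equiv.Perm (Fin m)) : Set ℕ :=
  {x ∈ bL1 i σ τ | pv σ i < x}

/-- `A_{3,b}`: the entries of `L₃` smaller than `η = σ_i + m - 1`. -/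
def A3b {n m : ℕ} (i : ℕ) (σ : Equiv.Perm (Fin n)) (τ : Equiv.Perm (Fin m)) : Set ℕ :=
  {x ∈ bL3 i σ τ | x < pv σ i + m - 1}

/-- `A_{3,t}`: the entries of `L₃` bigger than `η + l_σ`. -/
noncomputable def A3t {n m : ℕ} (i : ℕ) (σ : Equiv.Perm (Fin n)) (τ : Equiv.Perm (Fin m)) :
    Set ℕ := {x ∈ bL3 i σ τ | pv σ i + m - 1 + lpar i σ τ < x}

/-- `ρ ∈ S_{n+m-1}` is the permutation `T_i(σ,τ)`:  for `m = 1` it is `σ` itself;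
for `m ≥ 2` its three blocks standardize like those of `B_i(σ,τ)` and have the
prescribed entry sets. -/
noncomputable def IsT {n m : ℕ} (i : ℕ) (σ : Equiv.Perm (Fin n)) (τ : Equiv.Perm (Fin m))
    (ρ : Equiv.Perm (Fin (n + m - 1))) : Prop :=
  if m = 1 then (∀ p : ℕ, pv ρ p = pv σ p)
  else
    (∀ p q : ℕ, p < i → q < i → (pv ρ p < pv ρ q ↔ BFun i σ τ p < BFun i σ τ q)) ∧
    (∀ p q : ℕ, i ≤ p → p < i + m → i ≤ q → q < i + m →
      (pv ρ p < pv ρ q ↔ BFun i σ τ p < BFun i σ τ q)) ∧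
    (∀ p q : ℕ, i + m ≤ p → p < n + m - 1 → i + m ≤ q → q < n + m - 1 →
      (pv ρ p < pv ρ q ↔ BFun i σ τ p < BFun i σ τ q)) ∧
    pv ρ '' {p | p < i} =
      A1b i σ τ ∪
        Set.Ico (pv σ i + m - 1 + lpar i σ τ - kpar i σ τ) (pv σ i + m - 1 + lpar i σ τ) ∪
        A1t i σ τ ∧
    pv ρ '' {p | i ≤ p ∧ p < i + m} =
      insert (pv σ i - kpar i σ τ) (insert (pv σ i + m - 1 + lpar i σ τ)
        (Set.Ioo (pv σ i - kpar i σ τ + lpar i σ τ)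
          (pv σ i + m - 1 + lpar i σ τ - kpar i σ τ))) ∧
    pv ρ '' {p | i + m ≤ p ∧ p < n + m - 1} =
      A3b i σ τ ∪ Set.Ioc (pv σ i - kpar i σ τ) (pv σ i - kpar i σ τ + lpar i σ τ) ∪
        A3t i σ τ

/-- `u^ρ`: the minimum of the entries of the middle block `L₂(ρ)` (positions `[i, i+m-1]`). -/
noncomputable def uPar {N : ℕ} (i m : ℕ) (ρ : Equiv.Perm (Fin N)) : ℕ :=
  sInf (pv ρ '' {p | i ≤ p ∧ p < i + m})

/-- `v^ρ`: the maximum of the entries of the middle block `L₂(ρ)`. -/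
noncomputable def vPar {N : ℕ} (i m : ℕ) (ρ : Equiv.Perm (Fin N)) : ℕ :=
  sSup (pv ρ '' {p | i ≤ p ∧ p < i + m})

/-- `C_{1,m}^ρ`: the entries of the first block of `ρ` lying strictly between `u^ρ` and `v^ρ`. -/
noncomputable def Cmid1 {N : ℕ} (i m : ℕ) (ρ : Equiv.Perm (Fin N)) : Set ℕ :=
  {x ∈ pv ρ '' {p | p < i} | uPar i m ρ < x ∧ x < vPar i m ρ}

/-- `C_{3,m}^ρ`: the entries of the third block of `ρ` lying strictly between `u^ρ` and `v^ρ`. -/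
noncomputable def Cmid3 {N : ℕ} (i m : ℕ) (ρ : Equiv.Perm (Fin N)) : Set ℕ :=
  {x ∈ pv ρ '' {p | i + m ≤ p ∧ p < N} | uPar i m ρ < x ∧ x < vPar i m ρ}

/-- The sequence `(Bρ(1),…,Bρ(i-1), w, Bρ(i+m),…,Bρ(n+m-1))` of length `n`,
used to produce the first component of `P_i(ρ)` by standardization (here `w = u + n₁`). -/
def concatFun {N : ℕ} (i m w : ℕ) (β : Equiv.Perm (Fin N)) (r : ℕ) : ℕ :=
  if r < i then pv β r else if r = i then w else pv β (r + m - 1)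

/-- `P_i(ρ) = (σ,τ)`: for `m = 1` this means `σ = ρ` and `τ = id`; for `m ≥ 2` it is
expressed via the intermediate permutation `Bρ` (denoted `β`), whose blocks standardize
like those of `ρ` and have the prescribed entry sets, `σ` being the standardization of
`(β(1),…,β(i-1), u+n₁, β(i+m),…,β(n+m-1))` and `τ` the standardization of `L₂(ρ)`. -/
noncomputable def IsP {n m : ℕ} (i : ℕ) (ρ : Equiv.Perm (Fin (n + m - 1)))
    (σ : Equiv.Perm (Fin n)) (τ : Equiv.Perm (Fin m)) : Prop :=
  if m = 1 then (∀ p : ℕ, pv σ p = pv ρ p) ∧ τ = 1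
  else
    ∃ β : Equiv.Perm (Fin (n + m - 1)),
      (∀ p q : ℕ, p < i → q < i → (pv β p < pv β q ↔ pv ρ p < pv ρ q)) ∧
      (∀ p q : ℕ, i ≤ p → p < i + m → i ≤ q → q < i + m →
        (pv β p < pv β q ↔ pv ρ p < pv ρ q)) ∧
      (∀ p q : ℕ, i + m ≤ p → p < n + m - 1 → i + m ≤ q → q < n + m - 1 →
        (pv β p < pv β q ↔ pv ρ p < pv ρ q)) ∧
      pv β '' {p | p < i} =
        {x ∈ pv ρ '' {p | p < i} | x < uPar i m ρ} ∪
          Set.Ico (uPar i m ρ) (uPar i m ρ + (Cmid1 i m ρ).ncard) ∪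
          {x ∈ pv ρ '' {p | p < i} | vPar i m ρ < x} ∧
      pv β '' {p | i ≤ p ∧ p < i + m} =
        Set.Icc (uPar i m ρ + (Cmid1 i m ρ).ncard) (vPar i m ρ - (Cmid3 i m ρ).ncard) ∧
      pv β '' {p | i + m ≤ p ∧ p < n + m - 1} =
        {x ∈ pv ρ '' {p | i + m ≤ p ∧ p < n + m - 1} | x < uPar i m ρ} ∪
          Set.Ioc (vPar i m ρ - (Cmid3 i m ρ).ncard) (vPar i m ρ) ∪
          {x ∈ pv ρ '' {p | i + m ≤ p ∧ p < n + m - 1} | vPar i m ρ < x} ∧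
      (∀ p q : Fin n, σ p < σ q ↔
        concatFun i m (uPar i m ρ + (Cmid1 i m ρ).ncard) β p <
          concatFun i m (uPar i m ρ + (Cmid1 i m ρ).ncard) β q) ∧
      (∀ p q : Fin m, τ p < τ q ↔ pv ρ (i + p) < pv ρ (i + q))

/-- Two functions that compare alike below a lower set `C`, and whose images agree on `C`,
coincide wherever one of them takes values in `C`. -/
theorem eq_of_image_inter_lowerSet {ι α : Type*} [LinearOrder α] {S : Set ι} (hS : S.Finite)
    {f g : ι → α} {C : Set α} (hC : IsLowerSet C)
    (h : ∀ p ∈ S, ∀ q ∈ S, f p ∈ C → (f q < f p ↔ g q < g p))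
    (him : f '' S ∩ C = g '' S ∩ C) {p : ι} (hp : p ∈ S) (hfp : f p ∈ C) : f p = g p := by
  have key : ∀ x ∈ f '' S, ∀ p ∈ S, f p = x → f p ∈ C → f p = g p := by
    intro x hx
    refine Set.WellFoundedOn.induction (r := (· < ·))
      (P := fun x => ∀ p ∈ S, f p = x → f p ∈ C → f p = g p) (hS.image f).wellFoundedOn hx ?_
    rintro x - ih p hp rfl hpC
    rcases lt_trichotomy (f p) (g p) with hlt | heq | hgt
    · obtain ⟨⟨q, hq, hqp⟩, -⟩ : f p ∈ g '' S ∩ C := him ▸ ⟨⟨p, hp, rfl⟩, hpC⟩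
      have hfq : f q < f p := (h p hp q hq hpC).2 (hqp ▸ hlt)
      have := ih (f q) ⟨q, hq, rfl⟩ hfq q hq rfl (hC hfq.le hpC)
      exact absurd (this.trans hqp) hfq.ne
    · exact heq
    · obtain ⟨⟨q, hq, hqp⟩, hqC⟩ : g p ∈ f '' S ∩ C := him ▸ ⟨⟨p, hp, rfl⟩, hC hgt.le hpC⟩
      have hfq : f q < f p := hqp ▸ hgt
      have h1 := ih (f q) ⟨q, hq, rfl⟩ hfq q hq rfl (hqp ▸ hqC)
      exact absurd (h1.symm.trans hqp) ((h p hp q hq hpC).1 hfq).ne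
  exact key _ ⟨p, hp, rfl⟩ p hp rfl hfp

/-- The order dual of `eq_of_image_inter_lowerSet`. -/
theorem eq_of_image_inter_upperSet {ι α : Type*} [LinearOrder α] {S : Set ι} (hS : S.Finite)
    {f g : ι → α} {C : Set α} (hC : IsUpperSet C)
    (h : ∀ p ∈ S, ∀ q ∈ S, f p ∈ C → (f p < f q ↔ g p < g q))
    (him : f '' S ∩ C = g '' S ∩ C) {p : ι} (hp : p ∈ S) (hfp : f p ∈ C) : f p = g p :=
  eq_of_image_inter_lowerSet (α := αᵒᵈ) hS (f := f) (g := g) (C := C)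
    (fun _ _ hab ha => hC hab ha) h him hp hfp

theorem eq_of_image_inter_eq_of_mem_right {ι α : Type*} {S : Set ι} {f g : ι → α} {C : Set α}
    (hg : Set.InjOn g S) (h : ∀ p ∈ S, f p ∈ C → f p = g p)
    (him : f '' S ∩ C = g '' S ∩ C) {p : ι} (hp : p ∈ S) (hgp : g p ∈ C) : f p = g p := by
  obtain ⟨⟨q, hq, hqp⟩, hqC⟩ : g p ∈ f '' S ∩ C := him ▸ ⟨⟨p, hp, rfl⟩, hgp⟩
  have := h q hq (hqp ▸ hqC)
  rw [← hg hq hp (this.symm.trans hqp)]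
  exact this

section OneLine

variable {N : ℕ} (ρ : Equiv.Perm (Fin N))

theorem pv_lt {p : ℕ} (hp : p < N) : pv ρ p < N := by
  simp [pv, hp]

theorem pv_inj {p q : ℕ} (hp : p < N) (hq : q < N) (h : pv ρ p = pv ρ q) : p = q := by
  simpa [pv, hp, hq, Fin.val_inj] using h

theorem exists_pv_eq {x : ℕ} (hx : x < N) : ∃ p < N, pv ρ p = x :=
  ⟨ρ.symm ⟨x, hx⟩, (ρ.symm ⟨x, hx⟩).2, by simp [pv]⟩

theorem pv_fin (p : Fin N) : pv ρ p = ρ p := by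
  simp [pv]

theorem wle_iff_pv (σ τ : Equiv.Perm (Fin N)) :
    wle σ τ ↔ ∀ p q : ℕ, p < q → q < N → pv σ q < pv σ p → pv τ q < pv τ p := by
  constructor
  · intro h p q hpq hq hlt
    have := h ⟨p, hpq.trans hq⟩ ⟨q, hq⟩ hpq
    simp only [pv, hq, hpq.trans hq, dif_pos] at hlt ⊢
    exact this hlt
  · intro h p q hpq hlt
    have := h p q hpq q.2
    simp only [pv_fin] at this
    exact this hlt

end OneLine

/-- `u` and `v` are the minimum and maximum of `r` on the middle block `[i, i + m)`. -/
structure MidBounds (i m : ℕ) (r : ℕ → ℕ) (u v : ℕ) : Prop where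
  le : ∀ q, i ≤ q → q < i + m → u ≤ r q ∧ r q ≤ v
  min : ∃ q, i ≤ q ∧ q < i + m ∧ r q = u
  max : ∃ q, i ≤ q ∧ q < i + m ∧ r q = v

theorem midBounds_par {N i m : ℕ} (hm : 0 < m) (ρ : Equiv.Perm (Fin N)) :
    MidBounds i m (pv ρ) (uPar i m ρ) (vPar i m ρ) := by
  have hne : (pv ρ '' {p | i ≤ p ∧ p < i + m}).Nonempty := ⟨pv ρ i, i, ⟨le_rfl, by omega⟩, rfl⟩
  have hfin : (pv ρ '' {p | i ≤ p ∧ p < i + m}).Finite := (Set.finite_Ico i (i + m)).image _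
  refine ⟨fun q h1 h2 => ⟨Nat.sInf_le ⟨q, ⟨h1, h2⟩, rfl⟩,
    le_csSup hfin.bddAbove ⟨q, ⟨h1, h2⟩, rfl⟩⟩, ?_, ?_⟩
  · obtain ⟨q, ⟨h1, h2⟩, h⟩ := Nat.sInf_mem hne
    exact ⟨q, h1, h2, h⟩
  · obtain ⟨q, ⟨h1, h2⟩, h⟩ := Nat.sSup_mem hne hfin.bddAbove
    exact ⟨q, h1, h2, h⟩

/-- The comparisons characterizing `r` as an element of the fiber with least element `b`, where
`[s, e]` are the values of `b`, and `u`, `v` the extreme values of `r`, on the middle block. -/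
structure SameFiber (N i m : ℕ) (b r : ℕ → ℕ) (s e u v : ℕ) : Prop where
  left : ∀ p q, p < i → q < i → (b p < b q ↔ r p < r q)
  mid : ∀ p q, i ≤ p → p < i + m → i ≤ q → q < i + m → (b p < b q ↔ r p < r q)
  right : ∀ p q, i + m ≤ p → p < N → i + m ≤ q → q < N → (b p < b q ↔ r p < r q)
  left_mid : ∀ p, p < i → (b p < s ↔ r p < v)
  mid_right : ∀ q, i + m ≤ q → q < N → (e < b q ↔ u < r q)
  left_right : ∀ p q, p < i → i + m ≤ q → q < N →
    (b p < b q ↔ r p < r q ∨ (u < r p ∧ r p < v ∧ u < r q ∧ r q < v))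

/-- The entries of `b` at the middle block `[i, i + m)` are exactly those in `[s, s + m - 1]`. -/
def MidInterval (N i m : ℕ) (b : ℕ → ℕ) (s : ℕ) : Prop :=
  ∀ p < N, (s ≤ b p ∧ b p ≤ s + m - 1) ↔ (i ≤ p ∧ p < i + m)

/-- The explicit entries of the largest element `t` of the fiber with least element `b`: the runs
of `k` entries below and `l` entries above the middle block cross that block and each other. -/
structure TopShape (N i m : ℕ) (b t : ℕ → ℕ) (s k l : ℕ) : Prop where
  k_le : k ≤ s
  left_run : ∀ p, p < i → s - k ≤ b p → b p < s → t p = b p + (m - 1 + l)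
  left_low : ∀ p, p < i → b p < s - k → t p = b p
  left_high : ∀ p, p < i → s ≤ b p → t p = b p ∧ s + m - 1 + l < b p
  mid_min : ∀ p, i ≤ p → p < i + m → b p = s → t p = s - k
  mid_max : ∀ p, i ≤ p → p < i + m → b p = s + m - 1 → t p = s + m - 1 + l
  mid_mid : ∀ p, i ≤ p → p < i + m → s < b p → b p < s + m - 1 → t p + k = b p + l
  right_run : ∀ q, i + m ≤ q → q < N → s + m - 1 < b q → b q ≤ s + m - 1 + l →
    t q + (m - 1 + k) = b q
  right_high : ∀ q, i + m ≤ q → q < N → s + m - 1 + l < b q → t q = b q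
  right_low : ∀ q, i + m ≤ q → q < N → b q ≤ s + m - 1 → t q = b q ∧ b q < s - k
  left_run_of : ∀ p, p < i → b p < s →
    (∀ x < N, b p < b x → b x < s → x < i) → s - k ≤ b p
  right_run_of : ∀ q, i + m ≤ q → q < N → s + m - 1 < b q →
    (∀ x < N, b x < b q → s + m - 1 < b x → i + m ≤ x) → b q ≤ s + m - 1 + l

section Core

variable {N i m s k l u v : ℕ} {ρB ρ ρT : Equiv.Perm (Fin N)}

theorem TopShape.lt_left_mid {b t : ℕ → ℕ} (h : TopShape N i m b t s k l)
    (hb : MidInterval N i m b s) (hm : 2 ≤ m) (hN : i + m ≤ N) {p q : ℕ} (hp : p < i)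
    (hq : i ≤ q) (hq' : q < i + m) :
    t q < t p ↔ b q < b p ∨ (s - k ≤ b p ∧ b p < s ∧ b q ≠ s + m - 1) := by
  have hk := h.k_le
  have h1 := h.left_run p hp
  have h2 := h.left_low p hp
  have h3 := h.left_high p hp
  have h4 := h.mid_min q hq hq'
  have h5 := h.mid_max q hq hq'
  have h6 := h.mid_mid q hq hq'
  have h7 := (hb q (by omega)).2 ⟨hq, hq'⟩
  omega

theorem TopShape.lt_mid_right {b t : ℕ → ℕ} (h : TopShape N i m b t s k l)
    (hb : MidInterval N i m b s) (hm : 2 ≤ m) {p q : ℕ} (hp : i ≤ p)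
    (hp' : p < i + m) (hq : i + m ≤ q) (hq' : q < N) :
    t q < t p ↔ b q < b p ∨ (s + m - 1 < b q ∧ b q ≤ s + m - 1 + l ∧ b p ≠ s) := by
  have hk := h.k_le
  have h1 := h.right_run q hq hq'
  have h2 := h.right_low q hq hq'
  have h3 := h.right_high q hq hq'
  have h4 := h.mid_min p hp hp'
  have h5 := h.mid_max p hp hp'
  have h6 := h.mid_mid p hp hp'
  have h7 := (hb p (by omega)).2 ⟨hp, hp'⟩
  omega

theorem TopShape.lt_left_right {b t : ℕ → ℕ} (h : TopShape N i m b t s k l) (hm : 2 ≤ m)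
    {p q : ℕ} (hp : p < i) (hq : i + m ≤ q) (hq' : q < N) :
    t q < t p ↔ b q < b p ∨
      (s - k ≤ b p ∧ b p < s ∧ s + m - 1 < b q ∧ b q ≤ s + m - 1 + l) := by
  have hk := h.k_le
  have h1 := h.right_run q hq hq'
  have h2 := h.right_low q hq hq'
  have h3 := h.right_high q hq hq'
  have h4 := h.left_run p hp
  have h5 := h.left_low p hp
  have h6 := h.left_high p hp
  omega

theorem TopShape.lt_iff_left {b t : ℕ → ℕ} (h : TopShape N i m b t s k l)
    {p q : ℕ} (hp : p < i) (hq : q < i) : t q < t p ↔ b q < b p := by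
  have hk := h.k_le
  have h1 := h.left_run q hq
  have h2 := h.left_low q hq
  have h3 := h.left_high q hq
  have h4 := h.left_run p hp
  have h5 := h.left_low p hp
  have h6 := h.left_high p hp
  omega

theorem TopShape.lt_iff_right {b t : ℕ → ℕ} (h : TopShape N i m b t s k l)
    {p q : ℕ} (hp : i + m ≤ p) (hp' : p < N) (hq : i + m ≤ q) (hq' : q < N) :
    t q < t p ↔ b q < b p := by
  have hk := h.k_le
  have h1 := h.right_run q hq hq'
  have h2 := h.right_low q hq hq'
  have h3 := h.right_high q hq hq'
  have h4 := h.right_run p hp hp'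
  have h5 := h.right_low p hp hp'
  have h6 := h.right_high p hp hp'
  omega

theorem TopShape.lt_iff_mid {b t : ℕ → ℕ} (h : TopShape N i m b t s k l)
    (hb : MidInterval N i m b s) (hN : i + m ≤ N)
    {p q : ℕ} (hp : i ≤ p) (hp' : p < i + m) (hq : i ≤ q) (hq' : q < i + m) :
    t q < t p ↔ b q < b p := by
  have hk := h.k_le
  have h1 := h.mid_min p hp hp'
  have h2 := h.mid_max p hp hp'
  have h3 := h.mid_mid p hp hp'
  have h4 := h.mid_min q hq hq'
  have h5 := h.mid_max q hq hq'
  have h6 := h.mid_mid q hq hq'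
  have h7 := (hb p (by omega)).2 ⟨hp, hp'⟩
  have h8 := (hb q (by omega)).2 ⟨hq, hq'⟩
  omega

theorem wle_of_sameFiber (hb : MidInterval N i m (pv ρB) s)
    (hr : MidBounds i m (pv ρ) u v)
    (h : SameFiber N i m (pv ρB) (pv ρ) s (s + m - 1) u v) : wle ρB ρ := by
  rw [wle_iff_pv]
  intro p q hpq hq hlt
  have hp := hpq.trans hq
  have hbp := hb p hp
  have hbq := hb q hq
  have hrp := hr.le p
  have hrq := hr.le q
  have hne : pv ρ p ≠ pv ρ q := fun e => hpq.ne (pv_inj ρ hp hq e)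
  rcases lt_or_ge p i with hpi | hpi
  · have h1 := h.left_mid p hpi
    rcases lt_or_ge q i with hqi | hqi
    · exact (h.left q p hqi hpi).1 hlt
    · rcases lt_or_ge q (i + m) with hqm | hqm
      · omega
      · have := h.left_right p q hpi hqm hq
        omega
  · rcases lt_or_ge q (i + m) with hqm | hqm
    · exact (h.mid q p (by omega) hqm hpi (by omega)).1 hlt
    · rcases lt_or_ge p (i + m) with hpm | hpm
      · have := h.mid_right q hqm hq
        omega
      · exact (h.right q p hqm hq hpm hp).1 hlt

theorem SameFiber.left_run (hb : MidInterval N i m (pv ρB) s)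
    (h : SameFiber N i m (pv ρB) (pv ρ) s (s + m - 1) u v)
    (ht : TopShape N i m (pv ρB) (pv ρT) s k l) {p : ℕ} (hp : p < i)
    (hu : u < pv ρ p) (hv : pv ρ p < v) : s - k ≤ pv ρB p ∧ pv ρB p < s := by
  have hps := (h.left_mid p hp).2 hv
  refine ⟨ht.left_run_of p hp hps fun x hx hpx hxs => ?_, hps⟩
  by_contra hxi
  have hbx := hb x hx
  have h1 := h.mid_right x
  have h2 := h.left_right p x hp
  omega

theorem SameFiber.right_run (hb : MidInterval N i m (pv ρB) s)
    (h : SameFiber N i m (pv ρB) (pv ρ) s (s + m - 1) u v)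
    (ht : TopShape N i m (pv ρB) (pv ρT) s k l) {q : ℕ} (hq : i + m ≤ q) (hqN : q < N)
    (hu : u < pv ρ q) (hv : pv ρ q < v) :
    s + m - 1 < pv ρB q ∧ pv ρB q ≤ s + m - 1 + l := by
  have hqs := (h.mid_right q hq hqN).2 hu
  refine ⟨hqs, ht.right_run_of q hq hqN hqs fun x hx hxq hxs => ?_⟩
  by_contra hxi
  have hbx := hb x hx
  have h1 := h.left_mid x
  have h2 := h.left_right x q
  have hne : pv ρ x ≠ pv ρ q := fun e => by
    have := pv_inj ρ hx hqN e
    omega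
  omega

theorem wle_top_of_sameFiber (hm : 2 ≤ m) (hN : i + m ≤ N) (hb : MidInterval N i m (pv ρB) s)
    (hr : MidBounds i m (pv ρ) u v)
    (h : SameFiber N i m (pv ρB) (pv ρ) s (s + m - 1) u v)
    (ht : TopShape N i m (pv ρB) (pv ρT) s k l) : wle ρ ρT := by
  rw [wle_iff_pv]
  intro p q hpq hq hlt
  have hp := hpq.trans hq
  have hbp := hb p hp
  have hbq := hb q hq
  have hrp := hr.le p
  have hrq := hr.le q
  have hne : pv ρB p ≠ pv ρB q := fun e => hpq.ne (pv_inj ρB hp hq e)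
  obtain ⟨a, ha, ha', hau⟩ := hr.min
  obtain ⟨c, hc, hc', hcv⟩ := hr.max
  rcases lt_or_ge p i with hpi | hpi
  · have h1 := h.left_mid p hpi
    rcases lt_or_ge q i with hqi | hqi
    · exact (ht.lt_iff_left hpi hqi).2 ((h.left q p hqi hpi).2 hlt)
    · rcases lt_or_ge q (i + m) with hqm | hqm
      · rw [ht.lt_left_mid hb hm hN hpi hqi hqm]
        rcases lt_or_ge (pv ρB p) (pv ρB q) with hbpq | hbpq
        · have hv : pv ρ p < v := h1.1 (by omega)
          have hrun := h.left_run hb ht hpi (by omega) hv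
          have hqc := h.mid q c hqi hqm hc hc'
          have hbc := (hb c (by omega)).2 ⟨hc, hc'⟩
          omega
        · omega
      · rw [ht.lt_left_right hm hpi hqm hq]
        have := h.left_right p q hpi hqm hq
        rcases lt_or_ge (pv ρB p) (pv ρB q) with hbpq | hbpq
        · have h2 := h.left_run hb ht hpi
          have h3 := h.right_run hb ht hqm hq
          omega
        · omega
  · rcases lt_or_ge q (i + m) with hqm | hqm
    · exact (ht.lt_iff_mid hb hN hpi (by omega) (by omega) hqm).2
        ((h.mid q p (by omega) hqm hpi (by omega)).2 hlt)
    · rcases lt_or_ge p (i + m) with hpm | hpm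
      · rw [ht.lt_mid_right hb hm hpi hpm hqm hq]
        rcases lt_or_ge (pv ρB p) (pv ρB q) with hbpq | hbpq
        · have h1 := h.mid_right q hqm hq
          have hu : u < pv ρ q := h1.1 (by omega)
          have hrun := h.right_run hb ht hqm hq hu (by omega)
          have hqa := h.mid a p ha ha' hpi hpm
          have hba := (hb a (by omega)).2 ⟨ha, ha'⟩
          omega
        · omega
      · exact (ht.lt_iff_right hpm hp hqm hq).2 ((h.right q p hqm hq hpm hp).2 hlt)

/-- If the inversions of `r` lie between those of `b` and `t`, and `b` and `t` compare alike on
`p` and `q`, then so do `b` and `r`. -/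
theorem lt_iff_lt_of_squeeze {b r t : ℕ → ℕ} {p q : ℕ} (hpq : p ≠ q)
    (hbne : b p ≠ b q) (hrne : r p ≠ r q)
    (h1 : p < q → b q < b p → r q < r p) (h2 : p < q → r q < r p → t q < t p)
    (h1' : q < p → b p < b q → r p < r q) (h2' : q < p → r p < r q → t p < t q)
    (htb : t q < t p ↔ b q < b p) (htb' : t p < t q ↔ b p < b q) : b p < b q ↔ r p < r q := by
  omega

theorem sameFiber_of_wle (hm : 2 ≤ m) (hN : i + m ≤ N) (hb : MidInterval N i m (pv ρB) s)
    (hsN : s + m ≤ N)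
    (hr : MidBounds i m (pv ρ) u v) (ht : TopShape N i m (pv ρB) (pv ρT) s k l)
    (h₁ : wle ρB ρ) (h₂ : wle ρ ρT) :
    SameFiber N i m (pv ρB) (pv ρ) s (s + m - 1) u v := by
  rw [wle_iff_pv] at h₁ h₂
  have hinj : ∀ p q, p < N → q < N → pv ρ p = pv ρ q → p = q := fun p q => pv_inj ρ
  have hinjB : ∀ p q, p < N → q < N → pv ρB p = pv ρB q → p = q := fun p q => pv_inj ρB
  have squeeze : ∀ p q, p < N → q < N →
      (pv ρT q < pv ρT p ↔ pv ρB q < pv ρB p) → (pv ρT p < pv ρT q ↔ pv ρB p < pv ρB q) →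
      (pv ρB p < pv ρB q ↔ pv ρ p < pv ρ q) := by
    intro p q hp hq htb htb'
    rcases eq_or_ne p q with rfl | hpq
    · simp
    · exact lt_iff_lt_of_squeeze hpq (fun e => hpq (hinjB p q hp hq e))
        (fun e => hpq (hinj p q hp hq e)) (fun hlt => h₁ p q hlt hq) (fun hlt => h₂ p q hlt hq)
        (fun hlt => h₁ q p hlt hp) (fun hlt => h₂ q p hlt hp) htb htb'
  obtain ⟨a, ha, ha', hau⟩ := hr.min
  obtain ⟨c, hc, hc', hcv⟩ := hr.max
  obtain ⟨x, hx, hxs⟩ := exists_pv_eq ρB (show s < N by omega)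
  obtain ⟨y, hy, hys⟩ := exists_pv_eq ρB (show s + m - 1 < N by omega)
  have hxm := (hb x hx).1 (by omega)
  have hym := (hb y hy).1 (by omega)
  have hrx := hr.le x hxm.1 hxm.2
  have hry := hr.le y hym.1 hym.2
  have left_mid : ∀ p, p < i → (pv ρB p < s ↔ pv ρ p < v) := by
    intro p hp
    have h1 := h₁ p c (by omega) (by omega)
    have h2 := h₂ p y (by omega) hy
    rw [ht.lt_left_mid hb hm hN hp hym.1 hym.2] at h2
    have hbp := hb p (by omega)
    have hbc := (hb c (by omega)).2 ⟨hc, hc'⟩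
    have hne := hinj p y (by omega) hy
    omega
  have mid_right : ∀ q, i + m ≤ q → q < N → (s + m - 1 < pv ρB q ↔ u < pv ρ q) := by
    intro q hq hqN
    have h1 := h₁ a q (by omega) (by omega)
    have h2 := h₂ x q (by omega) hqN
    rw [ht.lt_mid_right hb hm hxm.1 hxm.2 hq hqN] at h2
    have hbq := hb q (by omega)
    have hba := (hb a (by omega)).2 ⟨ha, ha'⟩
    have hne := hinj x q hx hqN
    omega
  refine ⟨fun p q hp hq => squeeze p q (by omega) (by omega) (ht.lt_iff_left hp hq)
      (ht.lt_iff_left hq hp),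
    fun p q hp hp' hq hq' => squeeze p q (by omega) (by omega)
      (ht.lt_iff_mid hb hN hp hp' hq hq') (ht.lt_iff_mid hb hN hq hq' hp hp'),
    fun p q hp hp' hq hq' => squeeze p q hp' hq'
      (ht.lt_iff_right hp hp' hq hq') (ht.lt_iff_right hq hq' hp hp'),
    left_mid, mid_right, fun p q hp hq hqN => ?_⟩
  have h1 := h₁ p q (by omega) hqN
  have h2 := h₂ p q (by omega) hqN
  rw [ht.lt_left_right hm hp hq hqN] at h2
  have h3 := left_mid p hp
  have h4 := mid_right q hq hqN
  have hne := hinj p q (by omega) hqN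
  have hneB := hinjB p q (by omega) hqN
  omega

theorem MidBounds.ne_of_not_mid (hr : MidBounds i m (pv ρ) u v) (hN : i + m ≤ N) {p : ℕ}
    (hp : p < N) (hpi : p < i ∨ i + m ≤ p) : pv ρ p ≠ u ∧ pv ρ p ≠ v := by
  obtain ⟨a, ha, ham, hau⟩ := hr.min
  obtain ⟨c, hc, hcm, hcv⟩ := hr.max
  constructor
  · intro h
    have := pv_inj ρ hp (show a < N by omega) (h.trans hau.symm)
    omega
  · intro h
    have := pv_inj ρ hp (show c < N by omega) (h.trans hcv.symm)
    omega

theorem image_pv_eq (π π' : Equiv.Perm (Fin N)) :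
    pv π '' {p | p < N} = pv π' '' {p | p < N} := by
  have aux : ∀ π : Equiv.Perm (Fin N), pv π '' {p | p < N} = {p | p < N} := by
    intro π
    ext x
    constructor
    · rintro ⟨p, hp, rfl⟩
      exact pv_lt π hp
    · intro hx
      obtain ⟨p, hp, h⟩ := exists_pv_eq π hx
      exact ⟨p, hp, h⟩
  rw [aux, aux]

theorem SameFiber.eq_of_lt_min (hb : MidInterval N i m (pv ρB) s)
    (hr : MidBounds i m (pv ρ) u v)
    (h : SameFiber N i m (pv ρB) (pv ρ) s (s + m - 1) u v) (p : ℕ) (hp : p < N)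
    (hpu : pv ρ p < u ∨ pv ρB p < u) : pv ρ p = pv ρB p := by
  have huv : u ≤ v := by
    obtain ⟨a, ha, ham, rfl⟩ := hr.min
    exact (hr.le a ha ham).2
  have him : pv ρ '' {p | p < N} ∩ Set.Iio u = pv ρB '' {p | p < N} ∩ Set.Iio u := by
    rw [image_pv_eq ρ ρB]
  have low : ∀ p ∈ {p | p < N}, pv ρ p ∈ Set.Iio u → pv ρ p = pv ρB p := by
    intro p hp
    refine eq_of_image_inter_lowerSet (Set.finite_Iio N) (isLowerSet_Iio u) ?_ him hp
    intro p hp q hq hpu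
    have hp : p < N := hp
    have hq : q < N := hq
    have hpu : pv ρ p < u := hpu
    have h7 := hr.le p
    have h8 := hr.le q
    have h9 := hb p hp
    have h10 := hb q hq
    have h11 : pv ρ p = pv ρ q → p = q := pv_inj ρ hp hq
    have h12 : pv ρB p = pv ρB q → p = q := pv_inj ρB hp hq
    rcases lt_or_ge p i with hpi | hpi
    · have h3 := h.left_mid p hpi
      rcases lt_or_ge q i with hqi | hqi
      · exact (h.left q p hqi hpi).symm
      · have h5 := h.left_right p q hpi
        omega
    · have hpm : i + m ≤ p := by omega
      have h4 := h.mid_right p hpm hp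
      rcases lt_or_ge q i with hqi | hqi
      · have h6 := h.left_right q p hqi hpm hp
        omega
      · rcases lt_or_ge q (i + m) with hqm | hqm
        · omega
        · exact (h.right q p hqm hq hpm hp).symm
  rcases hpu with hpu | hpu
  · exact low p hp hpu
  · exact eq_of_image_inter_eq_of_mem_right (S := {p | p < N})
      (fun _ hx _ hy => pv_inj ρB hx hy) low him hp hpu

theorem SameFiber.eq_of_max_lt (hb : MidInterval N i m (pv ρB) s)
    (hr : MidBounds i m (pv ρ) u v)
    (h : SameFiber N i m (pv ρB) (pv ρ) s (s + m - 1) u v) (p : ℕ) (hp : p < N)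
    (hpv : v < pv ρ p ∨ v < pv ρB p) : pv ρ p = pv ρB p := by
  have huv : u ≤ v := by
    obtain ⟨a, ha, ham, rfl⟩ := hr.min
    exact (hr.le a ha ham).2
  have him : pv ρ '' {p | p < N} ∩ Set.Ioi v = pv ρB '' {p | p < N} ∩ Set.Ioi v := by
    rw [image_pv_eq ρ ρB]
  have high : ∀ p ∈ {p | p < N}, pv ρ p ∈ Set.Ioi v → pv ρ p = pv ρB p := by
    intro p hp
    refine eq_of_image_inter_upperSet (Set.finite_Iio N) (isUpperSet_Ioi v) ?_ him hp
    intro p hp q hq hpv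
    have hp : p < N := hp
    have hq : q < N := hq
    have hpv : v < pv ρ p := hpv
    have h7 := hr.le p
    have h8 := hr.le q
    have h9 := hb p hp
    have h10 := hb q hq
    have h11 : pv ρ p = pv ρ q → p = q := pv_inj ρ hp hq
    have h12 : pv ρB p = pv ρB q → p = q := pv_inj ρB hp hq
    rcases lt_or_ge p i with hpi | hpi
    · have h3 := h.left_mid p hpi
      rcases lt_or_ge q i with hqi | hqi
      · exact (h.left p q hpi hqi).symm
      · have h5 := h.left_right p q hpi
        omega
    · have hpm : i + m ≤ p := by omega
      have h4 := h.mid_right p hpm hp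
      rcases lt_or_ge q i with hqi | hqi
      · have h6 := h.left_right q p hqi hpm hp
        omega
      · rcases lt_or_ge q (i + m) with hqm | hqm
        · omega
        · exact (h.right p q hpm hp hqm hq).symm
  rcases hpv with hpv | hpv
  · exact high p hp hpv
  · exact eq_of_image_inter_eq_of_mem_right (S := {p | p < N})
      (fun _ hx _ hy => pv_inj ρB hx hy) high him hp hpv

end Core

section Parameters

variable {n m i : ℕ} {σ : Equiv.Perm (Fin n)} {τ : Equiv.Perm (Fin m)}
  {ρB ρT ρ : Equiv.Perm (Fin (n + m - 1))}

theorem IsB.left (hB : IsB i σ τ ρB) (hi : i < n) {p : ℕ} (hp : p < i) :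
    pv ρB p = avv m (pv σ i) (pv σ p) ∧ pv σ p ≠ pv σ i := by
  refine ⟨?_, fun e => hp.ne (pv_inj σ (hp.trans hi) hi e)⟩
  rw [hB p (by omega), BFun, if_pos hp]

theorem IsB.mid (hB : IsB i σ τ ρB) (hi : i < n) {j : ℕ} (hj : j < m) :
    pv ρB (i + j) = pv τ j + pv σ i := by
  rw [hB (i + j) (by omega), BFun, if_neg (by omega), if_pos (by omega), Nat.add_sub_cancel_left]

theorem IsB.right (hB : IsB i σ τ ρB) {r : ℕ} (hi : i < r) (hr : r < n) (hm : 0 < m) :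
    pv ρB (r + m - 1) = avv m (pv σ i) (pv σ r) ∧ pv σ r ≠ pv σ i := by
  refine ⟨?_, fun e => hi.ne' (pv_inj σ hr (hi.trans hr) e)⟩
  rw [hB _ (by omega), BFun, if_neg (by omega), if_neg (by omega),
    show r + m - 1 - m + 1 = r by omega]

theorem IsB.midInterval (hB : IsB i σ τ ρB) (hi : i < n) (hm : 0 < m) :
    MidInterval (n + m - 1) i m (pv ρB) (pv σ i) := by
  intro p hp
  rcases lt_or_ge p i with hpi | hpi
  · obtain ⟨h1, h2⟩ := hB.left hi hpi
    rw [h1, avv]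
    split_ifs <;> omega
  · rcases lt_or_ge p (i + m) with hpm | hpm
    · have h1 := hB.mid hi (show p - i < m by omega)
      rw [Nat.add_sub_of_le hpi] at h1
      have := pv_lt τ (show p - i < m by omega)
      omega
    · obtain ⟨h1, h2⟩ := hB.right (r := p - m + 1) (by omega) (by omega) hm
      rw [show p - m + 1 + m - 1 = p by omega] at h1
      rw [h1, avv]
      split_ifs <;> omega

theorem IsB.mem_bL1 (hB : IsB i σ τ ρB) (hi : i < n) {x : ℕ} :
    x ∈ bL1 i σ τ ↔ ∃ p < i, pv ρB p = x := by
  constructor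
  · rintro ⟨p, hp, rfl⟩
    exact ⟨p, hp, hB p (by have : p < i := hp; omega)⟩
  · rintro ⟨p, hp, rfl⟩
    exact ⟨p, hp, (hB p (by omega)).symm⟩

theorem IsB.mem_bL3 (hB : IsB i σ τ ρB) {x : ℕ} :
    x ∈ bL3 i σ τ ↔ ∃ p, (i + m ≤ p ∧ p < n + m - 1) ∧ pv ρB p = x := by
  constructor
  · rintro ⟨p, hp, rfl⟩
    exact ⟨p, hp, hB p hp.2⟩
  · rintro ⟨p, hp, rfl⟩
    exact ⟨p, hp, (hB p hp.2).symm⟩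

theorem IsB.kpar_spec (hB : IsB i σ τ ρB) (hi : i < n) :
    kpar i σ τ ≤ pv σ i ∧
      (∀ x, pv σ i - kpar i σ τ ≤ x → x < pv σ i → ∃ p < i, pv ρB p = x) ∧
      ∀ j ≤ pv σ i, (∀ x, pv σ i - j ≤ x → x < pv σ i → ∃ p < i, pv ρB p = x) →
        j ≤ kpar i σ τ := by
  set s := pv σ i
  have hbdd : BddAbove {j | j ≤ i ∧ j ≤ pv σ i ∧
      Set.Icc (pv σ i - j) (pv σ i) ⊆ insert (pv σ i) (bL1 i σ τ)} := ⟨i, fun j hj => hj.1⟩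
  have hmem : kpar i σ τ ∈ {j | j ≤ i ∧ j ≤ pv σ i ∧
      Set.Icc (pv σ i - j) (pv σ i) ⊆ insert (pv σ i) (bL1 i σ τ)} :=
    Nat.sSup_mem ⟨0, by simp⟩ hbdd
  refine ⟨hmem.2.1, fun x h1 h2 => ?_, fun j hj h => le_csSup hbdd ⟨?_, hj, ?_⟩⟩
  · rcases hmem.2.2 ⟨h1, h2.le⟩ with rfl | hx
    · exact absurd h2 (lt_irrefl _)
    · exact (hB.mem_bL1 hi).1 hx
  · have hsub : Finset.Ico (s - j) s ⊆ (Finset.range i).image (pv ρB) := by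
      intro x hx
      obtain ⟨p, hp, rfl⟩ := h x (Finset.mem_Ico.1 hx).1 (Finset.mem_Ico.1 hx).2
      exact Finset.mem_image_of_mem _ (Finset.mem_range.2 hp)
    have := (Finset.card_le_card hsub).trans Finset.card_image_le
    rw [Nat.card_Ico, Finset.card_range] at this
    omega
  · rintro x ⟨h1, h2⟩
    rcases h2.eq_or_lt with rfl | h2
    · exact Set.mem_insert _ _
    · exact Set.mem_insert_of_mem _ ((hB.mem_bL1 hi).2 (h x h1 h2))

theorem IsB.lpar_spec (hB : IsB i σ τ ρB) (hi : i < n) :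
    (∀ x, pv σ i + m - 1 < x → x ≤ pv σ i + m - 1 + lpar i σ τ →
        ∃ p, (i + m ≤ p ∧ p < n + m - 1) ∧ pv ρB p = x) ∧
      ∀ j, (∀ x, pv σ i + m - 1 < x → x ≤ pv σ i + m - 1 + j →
        ∃ p, (i + m ≤ p ∧ p < n + m - 1) ∧ pv ρB p = x) → j ≤ lpar i σ τ := by
  set e := pv σ i + m - 1 with he
  have hbdd : BddAbove {j | j ≤ n - 1 - i ∧
      Set.Icc (pv σ i + m - 1) (pv σ i + m - 1 + j) ⊆
        insert (pv σ i + m - 1) (bL3 i σ τ)} := ⟨n - 1 - i, fun j hj => hj.1⟩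
  have hmem : lpar i σ τ ∈ {j | j ≤ n - 1 - i ∧
      Set.Icc (pv σ i + m - 1) (pv σ i + m - 1 + j) ⊆
        insert (pv σ i + m - 1) (bL3 i σ τ)} :=
    Nat.sSup_mem ⟨0, by simp⟩ hbdd
  refine ⟨fun x h1 h2 => ?_, fun j h => le_csSup hbdd ⟨?_, ?_⟩⟩
  · rcases hmem.2 ⟨h1.le, h2⟩ with rfl | hx
    · exact absurd h1 (lt_irrefl _)
    · exact hB.mem_bL3.1 hx
  · have hsub : Finset.Ioc e (e + j) ⊆ (Finset.Ico (i + m) (n + m - 1)).image (pv ρB) := by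
      intro x hx
      obtain ⟨p, hp, rfl⟩ := h x (Finset.mem_Ioc.1 hx).1 (Finset.mem_Ioc.1 hx).2
      exact Finset.mem_image_of_mem _ (Finset.mem_Ico.2 hp)
    have := (Finset.card_le_card hsub).trans Finset.card_image_le
    rw [Nat.card_Ioc, Nat.card_Ico] at this
    omega
  · rintro x ⟨h1, h2⟩
    rcases h1.eq_or_lt with rfl | h1
    · exact Set.mem_insert _ _
    · exact Set.mem_insert_of_mem _ (hB.mem_bL3.2 (h x h1 h2))

theorem IsT.topShape (hT : IsT i σ τ ρT) (hB : IsB i σ τ ρB) (hi : i < n) (hm : 2 ≤ m) :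
    TopShape (n + m - 1) i m (pv ρB) (pv ρT) (pv σ i) (kpar i σ τ) (lpar i σ τ) := by
  rw [IsT, if_neg (by omega)] at hT
  obtain ⟨ho1, ho2, ho3, him1, him2, him3⟩ := hT
  obtain ⟨hk, hk1, hk2⟩ := hB.kpar_spec hi
  obtain ⟨hl1, hl2⟩ := hB.lpar_spec hi
  have hb := hB.midInterval hi (by omega)
  have hsn := pv_lt σ hi
  have mem1 : ∀ x, x ∈ bL1 i σ τ ↔ ∃ p < i, pv ρB p = x := fun x => hB.mem_bL1 hi
  have mem3 : ∀ x, x ∈ bL3 i σ τ ↔ ∃ p, (i + m ≤ p ∧ p < n + m - 1) ∧ pv ρB p = x :=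
    fun x => hB.mem_bL3
  have inj : ∀ p q, p < n + m - 1 → q < n + m - 1 → pv ρB p = pv ρB q → p = q :=
    fun p q => pv_inj ρB
  rw [A1b, A1t] at him1
  rw [A3b, A3t] at him3
  simp only [mem1] at him1
  simp only [mem3] at him3
  generalize kpar i σ τ = k at *
  generalize lpar i σ τ = l at *
  generalize hs : pv σ i = s at *
  have high1 : ∀ p, p < i → s ≤ pv ρB p → s + m - 1 + l < pv ρB p := by
    intro p hp hsp
    by_contra hlt
    have hbp := hb p (by omega)
    obtain ⟨q, hq, hqp⟩ := hl1 (pv ρB p) (by omega) (by omega)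
    have := inj q p hq.2 (by omega) hqp
    omega
  have low3 : ∀ q, i + m ≤ q → q < n + m - 1 → pv ρB q ≤ s + m - 1 → pv ρB q < s - k := by
    intro q hq hqN hsq
    by_contra hlt
    have hbq := hb q hqN
    obtain ⟨p, hp, hpq⟩ := hk1 (pv ρB q) (by omega) (by omega)
    have := inj p q (by omega) hqN hpq
    omega
  have eq1 : ∀ p, p < i →
      pv ρT p = if s - k ≤ pv ρB p ∧ pv ρB p < s then pv ρB p + (m - 1 + l) else pv ρB p := by
    intro p hp
    refine eq_of_image_inter_lowerSet (S := {p | p < i}) (Set.finite_Iio i)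
      (g := fun p => if s - k ≤ pv ρB p ∧ pv ρB p < s then pv ρB p + (m - 1 + l) else pv ρB p)
      isLowerSet_univ ?_ ?_ hp trivial
    · intro a ha c hc _
      have ha : a < i := ha
      have hc : c < i := hc
      rw [ho1 c a hc ha, ← hB c (by omega), ← hB a (by omega)]
      have := high1 a ha
      have := high1 c hc
      split_ifs <;> omega
    · rw [him1, Set.inter_univ, Set.inter_univ]
      ext x
      constructor
      · rintro ((⟨⟨a, ha, rfl⟩, hx⟩ | ⟨hx1, hx2⟩) | ⟨⟨a, ha, rfl⟩, hx⟩)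
        · exact ⟨a, ha, if_neg (by omega)⟩
        · obtain ⟨a, ha, hax⟩ := hk1 (x - (m - 1 + l)) (by omega) (by omega)
          exact ⟨a, ha, by dsimp only; rw [if_pos (by omega)]; omega⟩
        · exact ⟨a, ha, if_neg (by omega)⟩
      · rintro ⟨a, ha, rfl⟩
        have := high1 a ha
        dsimp only
        split_ifs with hrun
        · exact Or.inl (Or.inr ⟨by omega, by omega⟩)
        · rcases lt_or_ge (pv ρB a) s with hlt | hge
          · exact Or.inl (Or.inl ⟨⟨a, ha, rfl⟩, by omega⟩)
          · exact Or.inr ⟨⟨a, ha, rfl⟩, by omega⟩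
  have eq3 : ∀ q, i + m ≤ q → q < n + m - 1 →
      pv ρT q = if s + m - 1 < pv ρB q ∧ pv ρB q ≤ s + m - 1 + l then pv ρB q - (m - 1 + k)
        else pv ρB q := by
    intro p hp hpN
    refine eq_of_image_inter_lowerSet (S := {p | i + m ≤ p ∧ p < n + m - 1})
      (Set.finite_Ico (i + m) (n + m - 1))
      (g := fun q => if s + m - 1 < pv ρB q ∧ pv ρB q ≤ s + m - 1 + l
        then pv ρB q - (m - 1 + k) else pv ρB q)
      isLowerSet_univ ?_ ?_ ⟨hp, hpN⟩ trivial
    · rintro a ⟨ha, haN⟩ c ⟨hc, hcN⟩ _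
      rw [ho3 c a hc hcN ha haN, ← hB c (by omega), ← hB a (by omega)]
      have := low3 a ha haN
      have := low3 c hc hcN
      split_ifs <;> omega
    · rw [him3, Set.inter_univ, Set.inter_univ]
      ext x
      constructor
      · rintro ((⟨⟨a, ha, rfl⟩, hx⟩ | ⟨hx1, hx2⟩) | ⟨⟨a, ha, rfl⟩, hx⟩)
        · exact ⟨a, ha, if_neg (by omega)⟩
        · obtain ⟨a, ha, hax⟩ := hl1 (x + (m - 1 + k)) (by omega) (by omega)
          exact ⟨a, ha, by dsimp only; rw [if_pos (by omega)]; omega⟩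
        · exact ⟨a, ha, if_neg (by omega)⟩
      · rintro ⟨a, ha, rfl⟩
        have := low3 a ha.1 ha.2
        dsimp only
        split_ifs with hrun
        · exact Or.inl (Or.inr ⟨by omega, by omega⟩)
        · rcases le_or_gt (pv ρB a) (s + m - 1) with hlt | hge
          · exact Or.inl (Or.inl ⟨⟨a, ha, rfl⟩, by omega⟩)
          · exact Or.inr ⟨⟨a, ha, rfl⟩, by omega⟩
  have eq2 : ∀ p, i ≤ p → p < i + m →
      pv ρT p = if pv ρB p = s then s - k else if pv ρB p = s + m - 1 then s + m - 1 + l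
        else pv ρB p + l - k := by
    intro p hp hpm
    refine eq_of_image_inter_lowerSet (S := {p | i ≤ p ∧ p < i + m}) (Set.finite_Ico i (i + m))
      (g := fun p => if pv ρB p = s then s - k else if pv ρB p = s + m - 1 then s + m - 1 + l
        else pv ρB p + l - k)
      isLowerSet_univ ?_ ?_ ⟨hp, hpm⟩ trivial
    · rintro a ⟨ha, ham⟩ c ⟨hc, hcm⟩ _
      rw [ho2 c a hc hcm ha ham, ← hB c (by omega), ← hB a (by omega)]
      have := (hb a (by omega)).2 ⟨ha, ham⟩
      have := (hb c (by omega)).2 ⟨hc, hcm⟩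
      split_ifs <;> omega
    · have surj : ∀ y, s ≤ y → y ≤ s + m - 1 → ∃ a, (i ≤ a ∧ a < i + m) ∧ pv ρB a = y := by
        intro y h1 h2
        obtain ⟨a, ha, hay⟩ := exists_pv_eq ρB (show y < n + m - 1 by omega)
        exact ⟨a, (hb a ha).1 (by omega), hay⟩
      rw [him2, Set.inter_univ, Set.inter_univ]
      ext x
      constructor
      · rintro (rfl | rfl | ⟨hx1, hx2⟩)
        · obtain ⟨a, ha, hax⟩ := surj s le_rfl (by omega)
          exact ⟨a, ha, if_pos hax⟩
        · obtain ⟨a, ha, hax⟩ := surj (s + m - 1) (by omega) le_rfl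
          exact ⟨a, ha, by dsimp only; rw [if_neg (by omega), if_pos hax]⟩
        · obtain ⟨a, ha, hax⟩ := surj (x + k - l) (by omega) (by omega)
          exact ⟨a, ha, by dsimp only; rw [if_neg (by omega), if_neg (by omega)]; omega⟩
      · rintro ⟨a, ⟨ha, ham⟩, rfl⟩
        have := (hb a (by omega)).2 ⟨ha, ham⟩
        dsimp only
        split_ifs with h1 h2
        · exact Or.inl rfl
        · exact Or.inr (Or.inl rfl)
        · exact Or.inr (Or.inr ⟨by omega, by omega⟩)
  refine ⟨hk, ?_, ?_, ?_, ?_, ?_, ?_, ?_, ?_, ?_, ?_, ?_⟩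
  · intro p hp h1 h2
    rw [eq1 p hp, if_pos ⟨h1, h2⟩]
  · intro p hp h1
    rw [eq1 p hp, if_neg (by omega)]
  · intro p hp h1
    exact ⟨by rw [eq1 p hp, if_neg (by omega)], high1 p hp h1⟩
  · intro p hp hpm h1
    rw [eq2 p hp hpm, if_pos h1]
  · intro p hp hpm h1
    rw [eq2 p hp hpm, if_neg (by omega), if_pos h1]
  · intro p hp hpm h1 h2
    rw [eq2 p hp hpm, if_neg (by omega), if_neg (by omega)]
    omega
  · intro q hq hqN h1 h2
    rw [eq3 q hq hqN, if_pos ⟨h1, h2⟩]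
    omega
  · intro q hq hqN h1
    rw [eq3 q hq hqN, if_neg (by omega)]
  · intro q hq hqN h1
    exact ⟨by rw [eq3 q hq hqN, if_neg (by omega)], low3 q hq hqN h1⟩
  · intro p hp hps h
    have := hk2 (s - pv ρB p) (by omega) fun x h1 h2 => by
      obtain ⟨y, hy, rfl⟩ := exists_pv_eq ρB (show x < n + m - 1 by omega)
      rcases (show pv ρB p ≤ pv ρB y by omega).eq_or_lt with heq | hlt
      · exact ⟨p, hp, heq⟩
      · exact ⟨y, h y hy hlt h2, rfl⟩
    omega
  · intro q hq hqN hqs h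
    have hqlt := pv_lt ρB hqN
    have := hl2 (pv ρB q - (s + m - 1)) fun x h1 h2 => by
      obtain ⟨y, hy, rfl⟩ := exists_pv_eq ρB (show x < n + m - 1 by omega)
      rcases (show pv ρB y ≤ pv ρB q by omega).eq_or_lt with heq | hlt
      · exact ⟨q, ⟨hq, hqN⟩, heq.symm⟩
      · exact ⟨y, ⟨h y hy hlt h1, hy⟩, rfl⟩
    omega

theorem avv_lt_avv_iff {m s x y : ℕ} (hx : x ≠ s) (hy : y ≠ s) (hm : 0 < m) :
    avv m s x < avv m s y ↔ x < y := by
  simp only [avv]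
  split_ifs <;> omega

/-- If `f` has on `S` the entries of `g` with those in `[u, v]` replaced by a set `D ⊆ [u, v]`,
in the same relative order, then `f` and `g` agree outside `[u, v]`. -/
theorem eq_or_mem_of_image_eq {S D : Set ℕ} (hS : S.Finite) {f g : ℕ → ℕ} {u v : ℕ}
    (hg : Set.InjOn g S) (h : ∀ p q, p ∈ S → q ∈ S → (f p < f q ↔ g p < g q)) (huv : u ≤ v)
    (hD : D ⊆ Set.Icc u v)
    (him : f '' S = {x ∈ g '' S | x < u} ∪ D ∪ {x ∈ g '' S | v < x}) {p : ℕ} (hp : p ∈ S) :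
    (g p < u ∨ v < g p) ∧ f p = g p ∨ u ≤ g p ∧ g p ≤ v ∧ f p ∈ D := by
  have him₁ : f '' S ∩ Set.Iio u = g '' S ∩ Set.Iio u := by
    rw [him]
    ext x
    constructor
    · rintro ⟨(⟨h1, h2⟩ | h1) | ⟨h1, h2⟩, h3⟩
      · exact ⟨h1, h2⟩
      · exact absurd (hD h1).1 (not_le.2 h3)
      · exact absurd (huv.trans_lt h2) (not_lt.2 (le_of_lt h3))
    · rintro ⟨h1, h2⟩
      exact ⟨Or.inl (Or.inl ⟨h1, h2⟩), h2⟩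
  have him₂ : f '' S ∩ Set.Ioi v = g '' S ∩ Set.Ioi v := by
    rw [him]
    ext x
    constructor
    · rintro ⟨(⟨h1, h2⟩ | h1) | ⟨h1, h2⟩, h3⟩
      · exact absurd (huv.trans_lt h3) (not_lt.2 h2.le)
      · exact absurd (hD h1).2 (not_le.2 h3)
      · exact ⟨h1, h2⟩
    · rintro ⟨h1, h2⟩
      exact ⟨Or.inr ⟨h1, h2⟩, h2⟩
  have low : ∀ p ∈ S, f p ∈ Set.Iio u → f p = g p := fun p hp =>
    eq_of_image_inter_lowerSet hS (isLowerSet_Iio u) (fun p hp q hq _ => h q p hq hp) him₁ hp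
  have high : ∀ p ∈ S, f p ∈ Set.Ioi v → f p = g p := fun p hp =>
    eq_of_image_inter_upperSet hS (isUpperSet_Ioi v) (fun p hp q hq _ => h p q hp hq) him₂ hp
  rcases lt_or_ge (g p) u with hu | hu
  · exact Or.inl ⟨Or.inl hu, eq_of_image_inter_eq_of_mem_right hg low him₁ hp hu⟩
  rcases lt_or_ge v (g p) with hv | hv
  · exact Or.inl ⟨Or.inr hv, eq_of_image_inter_eq_of_mem_right hg high him₂ hp hv⟩
  refine Or.inr ⟨hu, hv, ?_⟩
  have hfp : f p ∈ f '' S := ⟨p, hp, rfl⟩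
  rw [him] at hfp
  rcases hfp with (⟨-, h1⟩ | h1) | ⟨-, h1⟩
  · exact absurd hu (not_le.2 (low p hp h1 ▸ h1))
  · exact h1
  · exact absurd hv (not_le.2 (high p hp h1 ▸ h1))

theorem image_eq_of_eq_outside {S D : Set ℕ} {f g : ℕ → ℕ} {u v : ℕ}
    (low : ∀ p ∈ S, g p < u → g p = f p) (high : ∀ p ∈ S, v < g p → g p = f p)
    (hD : f '' {p ∈ S | u ≤ g p ∧ g p ≤ v} = D) :
    f '' S = {x ∈ g '' S | x < u} ∪ D ∪ {x ∈ g '' S | v < x} := by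
  subst hD
  ext x
  constructor
  · rintro ⟨p, hp, rfl⟩
    rcases lt_or_ge (g p) u with hu | hu
    · exact Or.inl (Or.inl ⟨⟨p, hp, low p hp hu⟩, low p hp hu ▸ hu⟩)
    rcases lt_or_ge v (g p) with hv | hv
    · exact Or.inr ⟨⟨p, hp, high p hp hv⟩, high p hp hv ▸ hv⟩
    · exact Or.inl (Or.inr ⟨p, ⟨hp, hu, hv⟩, rfl⟩)
  · rintro ((⟨⟨p, hp, rfl⟩, h⟩ | ⟨p, ⟨hp, -⟩, rfl⟩) | ⟨⟨p, hp, rfl⟩, h⟩)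
    · exact ⟨p, hp, (low p hp h).symm⟩
    · exact ⟨p, hp, rfl⟩
    · exact ⟨p, hp, (high p hp h).symm⟩

theorem ncard_image_between {S D : Set ℕ} {f g : ℕ → ℕ} {u v : ℕ}
    (hf : Set.InjOn f S) (hg : Set.InjOn g S) (hne : ∀ p ∈ S, g p ≠ u ∧ g p ≠ v)
    (hD : f '' {p ∈ S | u ≤ g p ∧ g p ≤ v} = D) :
    {x ∈ g '' S | u < x ∧ x < v}.ncard = D.ncard := by
  have hsub : {p ∈ S | u ≤ g p ∧ g p ≤ v} ⊆ S := fun p hp => hp.1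
  have himg : {x ∈ g '' S | u < x ∧ x < v} = g '' {p ∈ S | u ≤ g p ∧ g p ≤ v} := by
    ext x
    constructor
    · rintro ⟨⟨p, hp, rfl⟩, h1, h2⟩
      exact ⟨p, ⟨hp, h1.le, h2.le⟩, rfl⟩
    · rintro ⟨p, ⟨hp, h1, h2⟩, rfl⟩
      exact ⟨⟨p, hp, rfl⟩, lt_of_le_of_ne h1 (hne p hp).1.symm, lt_of_le_of_ne h2 (hne p hp).2⟩
  rw [himg, ← hD, (hg.mono hsub).ncard_image, (hf.mono hsub).ncard_image]

theorem sameFiber_of_isP (hB : IsB i σ τ ρB) (hi : i < n) (hm : 2 ≤ m) (hP : IsP i ρ σ τ) :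
    SameFiber (n + m - 1) i m (pv ρB) (pv ρ) (pv σ i) (pv σ i + m - 1)
      (uPar i m ρ) (vPar i m ρ) := by
  rw [IsP, if_neg (by omega)] at hP
  obtain ⟨β, o1, -, o3, im1, im2, im3, hσ, hτ⟩ := hP
  have hr := midBounds_par (i := i) (by omega : 0 < m) ρ
  have hmid : ∀ p, i ≤ p → p < i + m → uPar i m ρ + (Cmid1 i m ρ).ncard ≤ pv β p ∧
      pv β p ≤ vPar i m ρ - (Cmid3 i m ρ).ncard := fun p h1 h2 =>
    (im2 ▸ ⟨p, ⟨h1, h2⟩, rfl⟩ : pv β p ∈ Set.Icc _ _)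
  have huw := Nat.le_add_right (uPar i m ρ) (Cmid1 i m ρ).ncard
  have hzv := Nat.sub_le (vPar i m ρ) (Cmid3 i m ρ).ncard
  clear im2
  generalize uPar i m ρ + (Cmid1 i m ρ).ncard = w at *
  generalize vPar i m ρ - (Cmid3 i m ρ).ncard = z at *
  generalize uPar i m ρ = u at *
  generalize vPar i m ρ = v at *
  have hwz : w ≤ z := (hmid i le_rfl (by omega)).1.trans (hmid i le_rfl (by omega)).2
  have ne := fun p => hr.ne_of_not_mid (p := p) (by omega)
  have cls1 : ∀ p, p < i → (pv ρ p < u ∨ v < pv ρ p) ∧ pv β p = pv ρ p ∨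
      u ≤ pv ρ p ∧ pv ρ p ≤ v ∧ u ≤ pv β p ∧ pv β p < w := by
    intro p hp
    refine eq_or_mem_of_image_eq (S := {p | p < i}) (D := Set.Ico u w) (Set.finite_Iio i)
      ?_ o1 (by omega) ?_ im1 hp
    · intro x hx y hy hxy
      have hx : x < i := hx
      have hy : y < i := hy
      exact pv_inj ρ (by omega) (by omega) hxy
    · rintro x ⟨h1, h2⟩
      exact ⟨h1, by omega⟩
  have cls3 : ∀ p, i + m ≤ p → p < n + m - 1 →
      (pv ρ p < u ∨ v < pv ρ p) ∧ pv β p = pv ρ p ∨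
      u ≤ pv ρ p ∧ pv ρ p ≤ v ∧ z < pv β p ∧ pv β p ≤ v := by
    intro p hp hpN
    refine eq_or_mem_of_image_eq (S := {p | i + m ≤ p ∧ p < n + m - 1}) (D := Set.Ioc z v)
      (Set.finite_Ico (i + m) (n + m - 1)) ?_ (fun x y hx hy => o3 x y hx.1 hx.2 hy.1 hy.2)
      (by omega) ?_ im3 ⟨hp, hpN⟩
    · exact fun x hx y hy hxy => pv_inj ρ hx.2 hy.2 hxy
    · rintro x ⟨h1, h2⟩
      exact ⟨by omega, h2⟩
  have conc : ∀ p q, p < n → q < n →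
      (pv σ p < pv σ q ↔ concatFun i m w β p < concatFun i m w β q) := by
    intro p q hp hq
    have := hσ ⟨p, hp⟩ ⟨q, hq⟩
    simpa [pv, hp, hq] using this
  have concL : ∀ p, p < i → concatFun i m w β p = pv β p := fun p hp => if_pos hp
  have concM : concatFun i m w β i = w := by simp [concatFun]
  have concR : ∀ q, i < q → concatFun i m w β q = pv β (q + m - 1) := fun q hq => by
    rw [concatFun, if_neg (by omega), if_neg (by omega)]
  have bR : ∀ q, i + m ≤ q → q < n + m - 1 →
      pv ρB q = avv m (pv σ i) (pv σ (q - m + 1)) ∧ pv σ (q - m + 1) ≠ pv σ i ∧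
      concatFun i m w β (q - m + 1) = pv β q := by
    intro q hq hqN
    obtain ⟨h1, h2⟩ := hB.right (r := q - m + 1) (by omega) (by omega) (by omega)
    have h3 := concR (q - m + 1) (by omega)
    rw [show q - m + 1 + m - 1 = q by omega] at h1 h3
    exact ⟨h1, h2, h3⟩
  refine ⟨?_, ?_, ?_, ?_, ?_, ?_⟩
  · intro p q hp hq
    obtain ⟨h1, h2⟩ := hB.left hi hp
    obtain ⟨h3, h4⟩ := hB.left hi hq
    rw [h1, h3, avv_lt_avv_iff h2 h4 (by omega), conc p q (by omega) (by omega), concL p hp,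
      concL q hq, o1 p q hp hq]
  · intro p q hp hpm hq hqm
    have h1 := hB.mid hi (show p - i < m by omega)
    have h2 := hB.mid hi (show q - i < m by omega)
    have h3 := hτ ⟨p - i, by omega⟩ ⟨q - i, by omega⟩
    have h4 := pv_fin τ ⟨p - i, by omega⟩
    have h5 := pv_fin τ ⟨q - i, by omega⟩
    simp only [Fin.lt_def, Nat.add_sub_of_le hp, Nat.add_sub_of_le hq] at h1 h2 h3 h4 h5
    rw [h1, h2, ← h3, h4, h5]
    omega
  · intro p q hp hpN hq hqN
    obtain ⟨h1, h2, h3⟩ := bR p hp hpN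
    obtain ⟨h4, h5, h6⟩ := bR q hq hqN
    rw [h1, h4, avv_lt_avv_iff h2 h5 (by omega), conc _ _ (by omega) (by omega), h3, h6,
      o3 p q hp hpN hq hqN]
  · intro p hp
    obtain ⟨h1, h2⟩ := hB.left hi hp
    have h3 := conc p i (by omega) hi
    rw [concL p hp, concM] at h3
    have h4 := cls1 p hp
    have h5 := ne p (by omega) (Or.inl hp)
    have h6 : pv ρB p < pv σ i ↔ pv σ p < pv σ i := by
      rw [h1, avv]
      split_ifs <;> omega
    omega
  · intro q hq hqN
    obtain ⟨h1, h2, h3⟩ := bR q hq hqN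
    have h4 := conc i (q - m + 1) hi (by omega)
    rw [h3, concM] at h4
    have h5 := cls3 q hq hqN
    have h6 := ne q hqN (Or.inr hq)
    have h7 : pv σ i + m - 1 < pv ρB q ↔ pv σ i < pv σ (q - m + 1) := by
      rw [h1, avv]
      split_ifs <;> omega
    omega
  · intro p q hp hq hqN
    obtain ⟨h1, h2⟩ := hB.left hi hp
    obtain ⟨h3, h4, h5⟩ := bR q hq hqN
    rw [h1, h3, avv_lt_avv_iff h2 h4 (by omega), conc _ _ (by omega) (by omega), concL p hp, h5]
    have h6 := cls1 p hp
    have h7 := cls3 q hq hqN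
    have h8 := ne p (by omega) (Or.inl hp)
    have h9 := ne q hqN (Or.inr hq)
    omega

theorem isP_of_sameFiber (hB : IsB i σ τ ρB) (hi : i < n) (hm : 2 ≤ m)
    (h : SameFiber (n + m - 1) i m (pv ρB) (pv ρ) (pv σ i) (pv σ i + m - 1)
      (uPar i m ρ) (vPar i m ρ)) : IsP i ρ σ τ := by
  have hr := midBounds_par (i := i) (by omega : 0 < m) ρ
  have hb := hB.midInterval hi (by omega)
  rw [IsP, if_neg (by omega)]
  have hsn := pv_lt σ hi
  have ne := fun p => hr.ne_of_not_mid (p := p) (by omega)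
  have hvN : vPar i m ρ < n + m - 1 := by
    obtain ⟨c, hc, hcm, hcv⟩ := hr.max
    exact hcv ▸ pv_lt ρ (by omega)
  have low := h.eq_of_lt_min hb hr
  have high := h.eq_of_max_lt hb hr
  have between : ∀ p, p < n + m - 1 → (uPar i m ρ ≤ pv ρ p ∧ pv ρ p ≤ vPar i m ρ ↔
      uPar i m ρ ≤ pv ρB p ∧ pv ρB p ≤ vPar i m ρ) := by
    intro p hp
    have h1 := low p hp
    have h3 := high p hp
    omega
  obtain ⟨x, hx, hxs⟩ := exists_pv_eq ρB (show pv σ i < n + m - 1 by omega)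
  obtain ⟨y, hy, hys⟩ := exists_pv_eq ρB (show pv σ i + m - 1 < n + m - 1 by omega)
  have hxm := (hb x hx).1 (by omega)
  have hym := (hb y hy).1 (by omega)
  have hus : uPar i m ρ ≤ pv σ i :=
    hxs ▸ ((between x hx).1 (hr.le x hxm.1 hxm.2)).1
  have hev : pv σ i + m - 1 ≤ vPar i m ρ :=
    hys ▸ ((between y hy).1 (hr.le y hym.1 hym.2)).2
  have him1 : pv ρB '' {p ∈ {p | p < i} | uPar i m ρ ≤ pv ρ p ∧ pv ρ p ≤ vPar i m ρ} =
      Set.Ico (uPar i m ρ) (pv σ i) := by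
    ext z
    constructor
    · rintro ⟨p, ⟨hp, hp'⟩, rfl⟩
      have hp : p < i := hp
      have h1 := (between p (by omega)).1 hp'
      have h2 := ne p (by omega) (Or.inl hp)
      have h3 := h.left_mid p hp
      exact ⟨h1.1, by omega⟩
    · rintro ⟨h1, h2⟩
      obtain ⟨p, hp, rfl⟩ := exists_pv_eq ρB (show z < n + m - 1 by omega)
      have h3 := (between p hp).2 (by omega)
      have h4 := hb p hp
      have h5 := h.mid_right p
      have h6 := ne p hp
      exact ⟨p, ⟨show p < i by omega, h3⟩, rfl⟩
  have him3 : pv ρB '' {p ∈ {p | i + m ≤ p ∧ p < n + m - 1} |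
      uPar i m ρ ≤ pv ρ p ∧ pv ρ p ≤ vPar i m ρ} =
      Set.Ioc (pv σ i + m - 1) (vPar i m ρ) := by
    ext z
    constructor
    · rintro ⟨p, ⟨⟨hp, hpN⟩, hp'⟩, rfl⟩
      have h1 := (between p hpN).1 hp'
      have h2 := ne p hpN (Or.inr hp)
      have h3 := h.mid_right p hp hpN
      exact ⟨by omega, h1.2⟩
    · rintro ⟨h1, h2⟩
      obtain ⟨p, hp, rfl⟩ := exists_pv_eq ρB (show z < n + m - 1 by omega)
      have h3 := (between p hp).2 (by omega)
      have h4 := hb p hp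
      have h5 := h.left_mid p
      have h6 := ne p hp
      exact ⟨p, ⟨⟨by omega, hp⟩, h3⟩, rfl⟩
  have inj1 : ∀ π : Equiv.Perm (Fin (n + m - 1)), Set.InjOn (pv π) {p | p < i} := by
    intro π x hx y hy hxy
    have hx : x < i := hx
    have hy : y < i := hy
    exact pv_inj π (by omega) (by omega) hxy
  have inj3 : ∀ π : Equiv.Perm (Fin (n + m - 1)),
      Set.InjOn (pv π) {p | i + m ≤ p ∧ p < n + m - 1} :=
    fun π x hx y hy hxy => pv_inj π hx.2 hy.2 hxy
  have hw : uPar i m ρ + (Cmid1 i m ρ).ncard = pv σ i := by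
    have := ncard_image_between (inj1 ρB) (inj1 ρ)
      (fun p hp => ne p (by have : p < i := hp; omega) (Or.inl hp)) him1
    rw [Cmid1, this, Set.ncard_eq_toFinset_card', Set.toFinset_Ico, Nat.card_Ico]
    omega
  have hz : vPar i m ρ - (Cmid3 i m ρ).ncard = pv σ i + m - 1 := by
    have := ncard_image_between (inj3 ρB) (inj3 ρ) (fun p hp => ne p hp.2 (Or.inr hp.1)) him3
    rw [Cmid3, this, Set.ncard_eq_toFinset_card', Set.toFinset_Ioc, Nat.card_Ioc]
    omega
  rw [hw, hz]
  refine ⟨ρB, h.left, h.mid, h.right, ?_, ?_, ?_, ?_, ?_⟩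
  · exact image_eq_of_eq_outside
      (fun p hp hu => low p (by have : p < i := hp; omega) (Or.inl hu))
      (fun p hp hv => high p (by have : p < i := hp; omega) (Or.inl hv)) him1
  · ext z
    constructor
    · rintro ⟨p, ⟨hp, hpm⟩, rfl⟩
      exact (hb p (by omega)).2 ⟨hp, hpm⟩
    · rintro ⟨h1, h2⟩
      obtain ⟨p, hp, rfl⟩ := exists_pv_eq ρB (show z < n + m - 1 by omega)
      exact ⟨p, (hb p hp).1 ⟨h1, h2⟩, rfl⟩
  · exact image_eq_of_eq_outside (fun p hp hu => low p hp.2 (Or.inl hu))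
      (fun p hp hv => high p hp.2 (Or.inl hv)) him3
  · have conc : ∀ r < n, concatFun i m (pv σ i) ρB r =
        if pv σ r ≤ pv σ i then pv σ r else pv σ r + m - 1 := by
      intro r hr
      rcases lt_trichotomy r i with hri | rfl | hri
      · obtain ⟨h1, h2⟩ := hB.left hi hri
        rw [concatFun, if_pos hri, h1, avv]
        split_ifs <;> omega
      · simp [concatFun]
      · obtain ⟨h1, h2⟩ := hB.right hri hr (by omega)
        rw [concatFun, if_neg (by omega), if_neg (by omega), h1, avv]
        split_ifs <;> omega
    intro p q
    rw [conc p p.2, conc q q.2, Fin.lt_def, ← pv_fin σ p, ← pv_fin σ q]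
    split_ifs <;> omega
  · intro p q
    rw [← h.mid _ _ (by omega) (by omega) (by omega) (by omega), hB.mid hi p.2, hB.mid hi q.2,
      pv_fin, pv_fin, Fin.lt_def]
    omega

end Parameters

/-- **Theorem.** The fiber of `P_i` over `(σ,τ)` is exactly the weak-order interval
`[B_i(σ,τ), T_i(σ,τ)]` in `S_{n+m-1}`. -/
theorem P_fiber_eq_interval {n m : ℕ} (hn : 1 ≤ n) (hm : 1 ≤ m) (i : ℕ) (hi : i < n)
    (σ : Equiv.Perm (Fin n)) (τ : Equiv.Perm (Fin m))
    (ρB ρT : Equiv.Perm (Fin (n + m - 1)))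
    (hB : IsB i σ τ ρB) (hT : IsT i σ τ ρT) :
    ∀ ρ : Equiv.Perm (Fin (n + m - 1)), IsP i ρ σ τ ↔ (wle ρB ρ ∧ wle ρ ρT) := by
  intro ρ
  rcases hm.eq_or_lt with rfl | hm
  · rw [IsT, if_pos rfl] at hT
    have hBσ : ∀ p, p < n → pv ρB p = pv σ p := by
      intro p hp
      rcases lt_trichotomy p i with hpi | rfl | hpi
      · rw [(hB.left hi hpi).1]
        simp [avv]
      · have h1 := hB.mid hi (show 0 < 1 by omega)
        have h2 := pv_lt τ (show 0 < 1 by omega)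
        simp only [Nat.add_zero] at h1
        omega
      · have h1 := (hB.right hpi hp (by omega)).1
        simpa [avv] using h1
    rw [IsP, if_pos rfl, wle_iff_pv, wle_iff_pv]
    constructor
    · rintro ⟨hP, -⟩
      refine ⟨fun p q hpq hq => ?_, fun p q hpq hq => ?_⟩
      · rw [hBσ p (by omega), hBσ q (by omega), hP p, hP q]
        exact id
      · rw [hT p, hT q, hP p, hP q]
        exact id
    · rintro ⟨h₁, h₂⟩
      refine ⟨?_, Subsingleton.elim _ _⟩
      have hrσ : ∀ p < n, pv ρ p = pv σ p := by
        intro p hp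
        refine eq_of_image_inter_lowerSet (S := {p | p < n}) (Set.finite_Iio n)
          isLowerSet_univ ?_ ?_ hp trivial
        · intro p hp q hq _
          have hp : p < n := hp
          have hq : q < n := hq
          rcases eq_or_ne q p with rfl | hqp
          · simp
          · refine (lt_iff_lt_of_squeeze (t := pv σ) hqp (fun e => hqp (pv_inj σ hq hp e))
              (fun e => hqp (pv_inj ρ hq hp e)) (fun hlt => ?_) (fun hlt => ?_)
              (fun hlt => ?_) (fun hlt => ?_) Iff.rfl Iff.rfl).symm
            · simpa only [hBσ p hp, hBσ q hq] using h₁ q p hlt hp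
            · simpa only [hT p, hT q] using h₂ q p hlt hp
            · simpa only [hBσ p hp, hBσ q hq] using h₁ p q hlt hq
            · simpa only [hT p, hT q] using h₂ p q hlt hq
        · rw [Set.inter_univ, Set.inter_univ]
          ext x
          constructor
          · rintro ⟨p, hp, rfl⟩
            obtain ⟨q, hq, h⟩ := exists_pv_eq σ (pv_lt ρ (p := p) hp)
            exact ⟨q, hq, h⟩
          · rintro ⟨p, hp, rfl⟩
            obtain ⟨q, hq, h⟩ := exists_pv_eq ρ (pv_lt σ (p := p) hp)
            exact ⟨q, hq, h⟩
      intro p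
      rcases lt_or_ge p n with hp | hp
      · exact (hrσ p hp).symm
      · rw [pv, dif_neg (by omega), pv, dif_neg (by omega)]
  · have hb := hB.midInterval hi (by omega)
    have ht := hT.topShape hB hi hm
    have hr := midBounds_par (i := i) (by omega : 0 < m) ρ
    have hs := pv_lt σ hi
    constructor
    · intro hP
      have h := sameFiber_of_isP hB hi hm hP
      exact ⟨wle_of_sameFiber hb hr h, wle_top_of_sameFiber hm (by omega) hb hr h ht⟩
    · rintro ⟨h₁, h₂⟩
      exact isP_of_sameFiber hB hi hm
        (sameFiber_of_wle hm (by omega) hb (by omega) hr ht h₁ h₂)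
end

section
/- Let n,m ≥ 1, 1 ≤ i ≤ n, σ ∈ S_n and τ ∈ S_m. For every ρ ∈ S_{n+m−1} with B_i(σ,τ) ≤ ρ ≤ T_i(σ,τ) in the left weak order, the number of global descents of ρ is at most the number of global descents of σ plus the number of global descents of τ: #GDes(ρ) ≤ #GDes(σ) + #GDes(τ). -/
open Equiv

/-- The descent set of a permutation, 0-indexed: `p ∈ Des σ` iff `σ_p > σ_{p+1}`
(so `Des σ ⊆ {0,…,N-2}`, corresponding to the 1-indexed set `[N-1]`). -/
def DesSet {N : ℕ} (σ : Equiv.Perm (Fin N)) : Set ℕ :=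
  {p | p + 1 < N ∧ pv σ (p + 1) < pv σ p}

/-- The set of global descents of a permutation, 0-indexed: `p ∈ GDes σ` iff
`σ_a > σ_b` for all `a ≤ p < b`. -/
def GDes {N : ℕ} (σ : Equiv.Perm (Fin N)) : Set ℕ :=
  {p | p + 1 < N ∧ ∀ a b : ℕ, a ≤ p → p < b → b < N → pv σ b < pv σ a}

/-- A permutation is closed when its descent set coincides with its set of global descents. -/
def ClosedPerm {N : ℕ} (σ : Equiv.Perm (Fin N)) : Prop := DesSet σ = GDes σ

theorem pv_of_lt {N : ℕ} (σ : Perm (Fin N)) {j : ℕ} (h : j < N) :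
    pv σ j = (σ ⟨j, h⟩ : ℕ) := by
  simp [pv, h]

theorem pv_injective {N : ℕ} (σ : Perm (Fin N)) : Function.Injective (pv σ) := by
  intro a b h
  have hlt : ∀ x : Fin N, (σ x : ℕ) < N := fun x => (σ x).isLt
  unfold pv at h
  split_ifs at h with ha hb hb
  · simpa using σ.injective (Fin.ext h)
  · have := hlt ⟨a, ha⟩
    omega
  · have := hlt ⟨b, hb⟩
    omega
  · exact h

theorem GDes_finite {N : ℕ} (σ : Perm (Fin N)) : (GDes σ).Finite :=
  (Set.finite_lt_nat N).subset fun p hp => by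
    have := hp.1
    simp only [Set.mem_ofPred_eq]
    omega

theorem GDes_subset_of_wle {N : ℕ} {σ τ : Perm (Fin N)} (h : wle σ τ) : GDes σ ⊆ GDes τ := by
  rintro p ⟨hp, hd⟩
  refine ⟨hp, fun a b ha hb hbN => ?_⟩
  have haN : a < N := by omega
  have := hd a b ha hb hbN
  rw [pv_of_lt σ hbN, pv_of_lt σ haN] at this
  rw [pv_of_lt τ hbN, pv_of_lt τ haN]
  exact h ⟨a, haN⟩ ⟨b, hbN⟩ (by simp only [Fin.mk_lt_mk]; omega) this

/-- Two functions with the same relative order on `P` and the same values below `c`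
agree wherever one of them is below `c`. -/
theorem eq_of_lt_of_image_inter_Iio_eq {f g : ℕ → ℕ} {P : Set ℕ} {c : ℕ}
    (hf : Set.InjOn f P)
    (hfg : ∀ p ∈ P, ∀ q ∈ P, f p < f q ↔ g p < g q)
    (himg : ∀ x < c, x ∈ f '' P ↔ x ∈ g '' P) :
    ∀ p ∈ P, f p < c → g p = f p := by
  suffices H : ∀ u, ∀ p ∈ P, f p = u → u < c → g p = u from
    fun p hp h => H _ p hp rfl h
  intro u
  induction u using Nat.strong_induction_on with
  | _ u ih =>
    rintro p hp rfl hc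
    obtain ⟨q, hq, hgq⟩ := (himg _ hc).1 ⟨p, hp, rfl⟩
    rcases lt_trichotomy (f q) (f p) with h | h | h
    · have := ih _ h q hq rfl (h.trans hc)
      omega
    · rw [← hf hq hp h, hgq, h]
    · have hgp : g p < f p := by
        rw [← hgq]
        exact (hfg p hp q hq).1 h
      obtain ⟨r, hr, hfr⟩ := (himg _ (hgp.trans hc)).2 ⟨p, hp, rfl⟩
      have hgr := ih _ hgp r hr hfr (hgp.trans hc)
      have := (hfg r hr p hp).1 (by omega)
      omega

/-- Two functions with the same relative order on a finite-valued `P` and the same values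
above `c` agree wherever one of them is above `c`. -/
theorem eq_of_lt_of_image_inter_Ioi_eq {f g : ℕ → ℕ} {P : Set ℕ} {c M : ℕ}
    (hf : Set.InjOn f P) (hM : ∀ p ∈ P, f p ≤ M)
    (hfg : ∀ p ∈ P, ∀ q ∈ P, f p < f q ↔ g p < g q)
    (himg : ∀ x, c < x → (x ∈ f '' P ↔ x ∈ g '' P)) :
    ∀ p ∈ P, c < f p → g p = f p := by
  suffices H : ∀ d, ∀ p ∈ P, M - f p = d → c < f p → g p = f p from
    fun p hp h => H _ p hp rfl h
  intro d
  induction d using Nat.strong_induction_on with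
  | _ d ih =>
    rintro p hp rfl hc
    obtain ⟨q, hq, hgq⟩ := (himg _ hc).1 ⟨p, hp, rfl⟩
    rcases lt_trichotomy (f q) (f p) with h | h | h
    · have hgp : f p < g p := by
        rw [← hgq]
        exact (hfg q hq p hp).1 h
      obtain ⟨r, hr, hfr⟩ := (himg _ (hc.trans hgp)).2 ⟨p, hp, rfl⟩
      have := hM r hr
      have hgr := ih (M - f r) (by omega) r hr rfl (by omega)
      have := (hfg p hp r hr).1 (by omega)
      omega
    · rw [← hf hq hp h, hgq, h]
    · have := hM q hq
      have := ih (M - f q) (by omega) q hq rfl (by omega)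
      omega

theorem pv_lt_s8 {N : ℕ} (σ : Perm (Fin N)) {j : ℕ} (h : j < N) : pv σ j < N := by
  rw [pv_of_lt σ h]
  exact (σ _).isLt

theorem lt_of_avv_lt {m s x y : ℕ} (hm : 1 ≤ m) (h : avv m s x < avv m s y) : x < y := by
  unfold avv at h
  split_ifs at h <;> omega

theorem BFun_left {n m i : ℕ} (σ : Perm (Fin n)) (τ : Perm (Fin m)) {j : ℕ} (h : j < i) :
    BFun i σ τ j = avv m (pv σ i) (pv σ j) := by
  simp [BFun, h]

theorem BFun_middle {n m i : ℕ} (σ : Perm (Fin n)) (τ : Perm (Fin m)) {j : ℕ} (h : j < m) :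
    BFun i σ τ (j + i) = pv τ j + pv σ i := by
  have h1 : ¬ j + i < i := by omega
  have h2 : j + i < i + m := by omega
  simp only [BFun, h1, h2, if_false, if_true, Nat.add_sub_cancel]

theorem BFun_right {n m i : ℕ} (σ : Perm (Fin n)) (τ : Perm (Fin m)) {j : ℕ} (hm : 1 ≤ m)
    (h : i < j) : BFun i σ τ (j + m - 1) = avv m (pv σ i) (pv σ j) := by
  have h1 : ¬ j + m - 1 < i := by omega
  have h2 : ¬ j + m - 1 < i + m := by omega
  have h3 : j + m - 1 - m + 1 = j := by omega
  simp only [BFun, h1, h2, h3, if_false]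

section Top

variable {n m i : ℕ} {σ : Perm (Fin n)} {τ : Perm (Fin m)} {ρ : Perm (Fin (n + m - 1))}

theorem IsT.left_eq_of_high (hi : i < n) (hm : 2 ≤ m) (hT : IsT i σ τ ρ) {p : ℕ} (hp : p < i)
    (h : pv σ i + m - 1 + lpar i σ τ < pv ρ p) : BFun i σ τ p = pv ρ p := by
  rw [IsT, if_neg (by omega)] at hT
  obtain ⟨hL, -, -, hA, -, -⟩ := hT
  refine eq_of_lt_of_image_inter_Ioi_eq (f := pv ρ) (P := {p | p < i}) (M := n + m)
    (pv_injective ρ).injOn (fun q hq => ?_) (fun p hp q hq => hL p q hp hq) (fun x hx => ?_)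
    p hp h
  · rw [Set.mem_ofPred_eq] at hq
    have := pv_lt_s8 ρ (j := q) (by omega)
    omega
  · rw [hA]
    simp only [A1b, A1t, bL1, Set.mem_union, Set.mem_Ico, Set.mem_ofPred_eq]
    constructor
    · rintro ((h | h) | h)
      · exact h.1
      · omega
      · exact h.1
    · exact fun h => Or.inr ⟨h, by omega⟩

theorem IsT.left_eq_of_low (hm : 2 ≤ m) (hT : IsT i σ τ ρ) {p : ℕ} (hp : p < i)
    (h : BFun i σ τ p < pv σ i - kpar i σ τ) : pv ρ p = BFun i σ τ p := by
  rw [IsT, if_neg (by omega)] at hT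
  obtain ⟨hL, -, -, hA, -, -⟩ := hT
  refine eq_of_lt_of_image_inter_Iio_eq (g := pv ρ) (P := {p | p < i})
    (fun p hp q hq h => ?_) (fun p hp q hq => (hL p q hp hq).symm) (fun x hx => ?_) p hp h
  · have h1 := hL p q hp hq
    have h2 := hL q p hq hp
    exact pv_injective ρ (by omega)
  · rw [hA]
    simp only [A1b, A1t, bL1, Set.mem_union, Set.mem_Ico, Set.mem_ofPred_eq]
    constructor
    · exact fun h => Or.inl (Or.inl ⟨h, hx⟩)
    · rintro ((h | h) | h)
      · exact h.1
      · omega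
      · exact h.1

theorem IsT.right_eq_of_high (hm : 2 ≤ m) (hT : IsT i σ τ ρ) {p : ℕ} (hp : i + m ≤ p)
    (hp' : p < n + m - 1) (h : pv σ i + m - 1 + lpar i σ τ < BFun i σ τ p) :
    pv ρ p = BFun i σ τ p := by
  rw [IsT, if_neg (by omega)] at hT
  obtain ⟨-, -, hR, -, -, hA⟩ := hT
  have hle : ∀ q, i + m ≤ q → q < n + m - 1 → BFun i σ τ q ≤ n + m := fun q hq hq' => by
    have := pv_lt_s8 σ (j := q - m + 1) (by omega)
    have h1 : ¬ q < i := by omega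
    have h2 : ¬ q < i + m := by omega
    simp only [BFun, h1, h2, if_false, avv]
    split_ifs <;> omega
  refine eq_of_lt_of_image_inter_Ioi_eq (g := pv ρ) (P := {p | i + m ≤ p ∧ p < n + m - 1})
    (M := n + m) (fun p hp q hq h => ?_) (fun q hq => hle q hq.1 hq.2)
    (fun p hp q hq => (hR p q hp.1 hp.2 hq.1 hq.2).symm) (fun x hx => ?_) p ⟨hp, hp'⟩ h
  · have h1 := hR p q hp.1 hp.2 hq.1 hq.2
    have h2 := hR q p hq.1 hq.2 hp.1 hp.2
    exact pv_injective ρ (by omega)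
  · rw [hA]
    simp only [A3b, A3t, bL3, Set.mem_union, Set.mem_Ioc, Set.mem_ofPred_eq]
    constructor
    · exact fun h => Or.inr ⟨h, hx⟩
    · rintro ((h | h) | h)
      · exact h.1
      · omega
      · exact h.1

theorem IsT.right_eq_of_low (hm : 2 ≤ m) (hT : IsT i σ τ ρ) {p : ℕ} (hp : i + m ≤ p)
    (hp' : p < n + m - 1) (h : pv ρ p < pv σ i - kpar i σ τ) :
    BFun i σ τ p = pv ρ p := by
  rw [IsT, if_neg (by omega)] at hT
  obtain ⟨-, -, hR, -, -, hA⟩ := hT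
  refine eq_of_lt_of_image_inter_Iio_eq (f := pv ρ) (P := {p | i + m ≤ p ∧ p < n + m - 1})
    (pv_injective ρ).injOn (fun p hp q hq => hR p q hp.1 hp.2 hq.1 hq.2) (fun x hx => ?_)
    p ⟨hp, hp'⟩ h
  rw [hA]
  simp only [A3b, A3t, bL3, Set.mem_union, Set.mem_Ioc, Set.mem_ofPred_eq]
  constructor
  · rintro ((h | h) | h)
    · exact h.1
    · omega
    · exact h.1
  · exact fun h => Or.inl (Or.inl ⟨h, by omega⟩)

/-- A global descent of `T_i(σ,τ)` before the end of the first block is one of `σ`. -/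
theorem IsT.mem_GDes_left (hi : i < n) (hm : 2 ≤ m) (hT : IsT i σ τ ρ) {p : ℕ} (hp : p < i)
    (hd : p ∈ GDes ρ) : p ∈ GDes σ := by
  have hT' := hT
  rw [IsT, if_neg (by omega)] at hT'
  obtain ⟨hL, -, -, -, hA, -⟩ := hT'
  obtain ⟨r, hr, hηr⟩ : pv σ i + m - 1 + lpar i σ τ ∈ pv ρ '' {p | i ≤ p ∧ p < i + m} := by
    rw [hA]
    simp
  rw [Set.mem_ofPred_eq] at hr
  refine ⟨by omega, fun a b ha hb hbn => ?_⟩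
  have hTa : pv σ i + m - 1 + lpar i σ τ < pv ρ a := hηr ▸ hd.2 a r ha (by omega) (by omega)
  have hBa := hT.left_eq_of_high hi hm (p := a) (by omega) hTa
  have hBa' := BFun_left σ τ (j := a) (i := i) (by omega)
  rcases lt_trichotomy b i with hbi | rfl | hbi
  · refine lt_of_avv_lt (m := m) (s := pv σ i) (by omega) ?_
    rw [← hBa', ← BFun_left σ τ hbi, ← hL b a hbi (by omega)]
    exact hd.2 a b ha hb (by omega)
  · refine lt_of_avv_lt (m := m) (s := pv σ b) (by omega) ?_
    rw [← hBa', hBa]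
    simp only [avv, lt_irrefl, if_false]
    omega
  · refine lt_of_avv_lt (m := m) (s := pv σ i) (by omega) ?_
    rw [← hBa', ← BFun_right σ τ (by omega) hbi, hBa]
    have hTb := hd.2 a (b + m - 1) ha (by omega) (by omega)
    by_contra hcon
    have := hT.right_eq_of_high hm (p := b + m - 1) (by omega) (by omega) (by omega)
    omega

/-- A global descent of `T_i(σ,τ)` inside the middle block is one of `τ`. -/
theorem IsT.mem_GDes_middle (hi : i < n) (hm : 2 ≤ m) (hT : IsT i σ τ ρ) {p : ℕ}
    (hp : p + 1 < m) (hd : p + i ∈ GDes ρ) : p ∈ GDes τ := by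
  rw [IsT, if_neg (by omega)] at hT
  refine ⟨hp, fun a b ha hb hbm => ?_⟩
  have h := hd.2 (a + i) (b + i) (by omega) (by omega) (by omega)
  rw [hT.2.1 _ _ (by omega) (by omega) (by omega) (by omega), BFun_middle σ τ hbm,
    BFun_middle σ τ (by omega)] at h
  omega

/-- A global descent of `T_i(σ,τ)` from the end of the middle block on comes from one of `σ`. -/
theorem IsT.mem_GDes_right (hm : 2 ≤ m) (hT : IsT i σ τ ρ) {p : ℕ} (hp : i ≤ p)
    (hd : p + m - 1 ∈ GDes ρ) : p ∈ GDes σ := by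
  have hT' := hT
  rw [IsT, if_neg (by omega)] at hT'
  obtain ⟨-, -, hR, -, hA, -⟩ := hT'
  obtain ⟨r, hr, hηr⟩ : pv σ i - kpar i σ τ ∈ pv ρ '' {p | i ≤ p ∧ p < i + m} := by
    rw [hA]
    simp
  rw [Set.mem_ofPred_eq] at hr
  have hpn := hd.1
  refine ⟨by omega, fun a b ha hb hbn => ?_⟩
  have hTb : pv ρ (b + m - 1) < pv σ i - kpar i σ τ :=
    hηr ▸ hd.2 r (b + m - 1) (by omega) (by omega) (by omega)
  have hBb := hT.right_eq_of_low hm (p := b + m - 1) (by omega) (by omega) hTb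
  have hBb' := BFun_right σ τ (j := b) (i := i) (m := m) (by omega) (by omega)
  rcases lt_trichotomy a i with hai | rfl | hai
  · refine lt_of_avv_lt (m := m) (s := pv σ i) (by omega) ?_
    rw [← hBb', ← BFun_left σ τ hai, hBb]
    have hTa := hd.2 a (b + m - 1) (by omega) (by omega) (by omega)
    by_contra hcon
    have := hT.left_eq_of_low hm (p := a) hai (by omega)
    omega
  · refine lt_of_avv_lt (m := m) (s := pv σ a) (by omega) ?_
    rw [← hBb', hBb]
    simp only [avv, lt_irrefl, if_false]
    omega
  · refine lt_of_avv_lt (m := m) (s := pv σ i) (by omega) ?_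
    rw [← hBb', ← BFun_right σ τ (by omega) hai,
      ← hR _ _ (by omega) (by omega) (by omega) (by omega)]
    exact hd.2 _ _ (by omega) (by omega) (by omega)

theorem IsT.GDes_subset (hi : i < n) (hm : 2 ≤ m) (hT : IsT i σ τ ρ) :
    GDes ρ ⊆ (fun p => if p < i then p else p + m - 1) '' GDes σ ∪ (· + i) '' GDes τ := by
  intro p hp
  by_cases h1 : p < i
  · exact Or.inl ⟨p, hT.mem_GDes_left hi hm h1 hp, if_pos h1⟩
  by_cases h2 : p - i + 1 < m
  · have h3 : p - i + i = p := by omega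
    exact Or.inr ⟨p - i, hT.mem_GDes_middle hi hm h2 (by rwa [h3]), h3⟩
  · have h3 : p + 1 - m + m - 1 = p := by omega
    have h4 : ¬ p + 1 - m < i := by omega
    exact Or.inl ⟨p + 1 - m, hT.mem_GDes_right hm (by omega) (by rwa [h3]),
      (if_neg h4).trans h3⟩

end Top

/-- **Theorem.** Every permutation `ρ` in the weak-order interval
`[B_i(σ,τ), T_i(σ,τ)]` has at most `#GDes(σ) + #GDes(τ)` global descents. -/
theorem GDes_card_le {n m : ℕ} (hn : 1 ≤ n) (hm : 1 ≤ m) (i : ℕ) (hi : i < n)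
    (σ : Equiv.Perm (Fin n)) (τ : Equiv.Perm (Fin m))
    (ρB ρT ρ : Equiv.Perm (Fin (n + m - 1)))
    (hB : IsB i σ τ ρB) (hT : IsT i σ τ ρT)
    (h1 : wle ρB ρ) (h2 : wle ρ ρT) :
    (GDes ρ).ncard ≤ (GDes σ).ncard + (GDes τ).ncard := by
  refine (Set.ncard_le_ncard (GDes_subset_of_wle h2) (GDes_finite ρT)).trans ?_
  by_cases hm1 : m = 1
  · subst hm1
    rw [IsT, if_pos rfl] at hT
    have h : GDes ρT = GDes σ := by
      ext p
      simp only [GDes, hT, Set.mem_ofPred_eq, Nat.add_sub_cancel]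
    rw [h]
    exact Nat.le_add_right _ _
  · have hσ := GDes_finite σ
    have hτ := GDes_finite τ
    calc (GDes ρT).ncard
        ≤ ((fun p => if p < i then p else p + m - 1) '' GDes σ ∪ (· + i) '' GDes τ).ncard :=
          Set.ncard_le_ncard (hT.GDes_subset hi (by omega)) ((hσ.image _).union (hτ.image _))
      _ ≤ _ := Set.ncard_union_le _ _
      _ ≤ _ := Nat.add_le_add (Set.ncard_image_le hσ) (Set.ncard_image_le hτ)
end

section
/- Let n,m ≥ 1, 1 ≤ i ≤ n, S ⊆ [n−1] and T ⊆ [m−1]. Then in the free ℤ-module ℤQ_{n+m−1} one has M_S ∘_i M_T = M_{B_i(S,T)}. Equivalently, for fixed S and T the map (S',T') ↦ B_i(S',T') is a bijection from {(S',T') : S ⊆ S' ⊆ [n−1] and T ⊆ T' ⊆ [m−1]} onto {R : B_i(S,T) ⊆ R ⊆ [n+m−2]}. -/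
/-- The insertion operation on finite subsets (0-indexed): for `S ⊆ {0,…,n-2}`,
`T ⊆ {0,…,m-2}` and insertion position `i < n`,
`B_i(S,T) = (S ∩ [0,i-1]) ∪ (T + i) ∪ ((S ∩ [i,n-2]) + (m-1))`. -/
def BFset (m i : ℕ) (S T : Finset ℕ) : Finset ℕ :=
  (S.filter (fun p => p < i)) ∪ (T.image (· + i)) ∪ ((S.filter (fun p => i ≤ p)).image (· + (m - 1)))

/-- The monomial basis element `M_S = Σ_{S ⊆ T ⊆ [N-1]} (-1)^{#(T∖S)} F_T` in the free
`ℤ`-module on subsets of `[N-1]` (0-indexed: subsets of `{0,…,N-2}`),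
where `F_T = Finsupp.single T 1`. -/
noncomputable def Mq (N : ℕ) (S : Finset ℕ) : Finset ℕ →₀ ℤ :=
  ∑ T ∈ (Finset.range (N - 1)).powerset.filter (fun T => S ⊆ T),
    ((-1 : ℤ) ^ ((T \ S).card)) • Finsupp.single T (1 : ℤ)

/-- The bilinear composition `∘_i : ℤQ_n × ℤQ_m → ℤQ_{n+m-1}` determined by
`F_S ∘_i F_T = F_{B_i(S,T)}`. -/
noncomputable def circQ (m i : ℕ) (x y : Finset ℕ →₀ ℤ) : Finset ℕ →₀ ℤ :=
  x.sum fun S c => y.sum fun T d => (c * d) • Finsupp.single (BFset m i S T) (1 : ℤ)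

theorem mem_BFset {m i x : ℕ} {S T : Finset ℕ} :
    x ∈ BFset m i S T ↔ (x < i ∧ x ∈ S) ∨ (i ≤ x ∧ x - i ∈ T) ∨
      (i + (m - 1) ≤ x ∧ x - (m - 1) ∈ S) := by
  simp only [BFset, Finset.mem_union, Finset.mem_filter, Finset.mem_image, or_assoc]
  refine or_congr and_comm (or_congr ?_ ?_)
  · constructor
    · rintro ⟨a, ha, rfl⟩
      exact ⟨by omega, by simpa using ha⟩
    · rintro ⟨h, hx⟩
      exact ⟨_, hx, by omega⟩
  · constructor
    · rintro ⟨a, ⟨ha, hi⟩, rfl⟩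
      exact ⟨by omega, by simpa using ha⟩
    · rintro ⟨h, hx⟩
      exact ⟨_, ⟨hx, by omega⟩, by omega⟩

theorem mem_BFset_of_lt {m i x : ℕ} {S T : Finset ℕ} (hx : x < i) :
    x ∈ BFset m i S T ↔ x ∈ S := by
  rw [mem_BFset]
  have h₁ : ¬ i ≤ x := by omega
  have h₂ : ¬ i + (m - 1) ≤ x := by omega
  simp [hx, h₁, h₂]

theorem add_mem_BFset {m i x : ℕ} {S T : Finset ℕ} (hx : x < m - 1) :
    x + i ∈ BFset m i S T ↔ x ∈ T := by
  rw [mem_BFset]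
  have h : ¬ i + (m - 1) ≤ x + i := by omega
  simp [h]

theorem add_sub_one_mem_BFset {m i x : ℕ} {S T : Finset ℕ} (hT : T ⊆ Finset.range (m - 1))
    (hx : i ≤ x) : x + (m - 1) ∈ BFset m i S T ↔ x ∈ S := by
  rw [mem_BFset]
  have h₁ : ¬ x + (m - 1) < i := by omega
  have h₂ : x + (m - 1) - i ∉ T := fun h => by
    have := Finset.mem_range.mp (hT h)
    omega
  simp [h₁, h₂, hx]

theorem BFset_mono {m i : ℕ} {S S' T T' : Finset ℕ} (hS : S ⊆ S') (hT : T ⊆ T') :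
    BFset m i S T ⊆ BFset m i S' T' := by
  intro x
  simp only [mem_BFset]
  rintro (h | h | h)
  · exact .inl ⟨h.1, hS h.2⟩
  · exact .inr (.inl ⟨h.1, hT h.2⟩)
  · exact .inr (.inr ⟨h.1, hS h.2⟩)

theorem BFset_subset_range {n m i : ℕ} {S T : Finset ℕ} (hm : 1 ≤ m) (hi : i < n)
    (hS : S ⊆ Finset.range (n - 1)) (hT : T ⊆ Finset.range (m - 1)) :
    BFset m i S T ⊆ Finset.range (n + m - 2) := by
  intro x hx
  rw [Finset.mem_range]
  rcases mem_BFset.mp hx with h | h | h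
  · omega
  · have := Finset.mem_range.mp (hT h.2)
    omega
  · have := Finset.mem_range.mp (hS h.2)
    omega

theorem subset_of_BFset_subset {m i : ℕ} {S S' T T' : Finset ℕ} (hT : T ⊆ Finset.range (m - 1))
    (hT' : T' ⊆ Finset.range (m - 1)) (h : BFset m i S T ⊆ BFset m i S' T') :
    S ⊆ S' ∧ T ⊆ T' := by
  constructor
  · intro x hx
    rcases lt_or_ge x i with hxi | hxi
    · exact (mem_BFset_of_lt hxi).mp (h ((mem_BFset_of_lt hxi).mpr hx))
    · exact (add_sub_one_mem_BFset hT' hxi).mp (h ((add_sub_one_mem_BFset hT hxi).mpr hx))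
  · intro x hx
    have hxm := Finset.mem_range.mp (hT hx)
    exact (add_mem_BFset hxm).mp (h ((add_mem_BFset hxm).mpr hx))

theorem exists_BFset_eq {n m i : ℕ} (hm : 1 ≤ m) (hi : i < n) {R : Finset ℕ}
    (hR : R ⊆ Finset.range (n + m - 2)) :
    ∃ S ⊆ Finset.range (n - 1), ∃ T ⊆ Finset.range (m - 1), BFset m i S T = R := by
  refine ⟨(Finset.range (n - 1)).filter
      (fun p => (p < i ∧ p ∈ R) ∨ (i ≤ p ∧ p + (m - 1) ∈ R)), Finset.filter_subset _ _,
    (Finset.range (m - 1)).filter (fun p => p + i ∈ R), Finset.filter_subset _ _, ?_⟩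
  ext x
  simp only [mem_BFset, Finset.mem_filter, Finset.mem_range]
  constructor
  · rintro (⟨h, -, h' | h'⟩ | ⟨h, -, h'⟩ | ⟨h, -, h' | h'⟩)
    · exact h'.2
    · omega
    · rwa [Nat.sub_add_cancel h] at h'
    · omega
    · rw [Nat.sub_add_cancel (by omega)] at h'
      exact h'.2
  · intro hx
    have hxr := Finset.mem_range.mp (hR hx)
    rcases lt_or_ge x i with h | h
    · exact .inl ⟨h, by omega, .inl ⟨h, hx⟩⟩
    rcases lt_or_ge x (i + (m - 1)) with h' | h'
    · exact .inr (.inl ⟨h, by omega, by rwa [Nat.sub_add_cancel h]⟩)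
    · exact .inr (.inr ⟨h', by omega, .inr ⟨by omega, by rwa [Nat.sub_add_cancel (by omega)]⟩⟩)

theorem bijOn_BFset {n m i : ℕ} (hm : 1 ≤ m) (hi : i < n) {S T : Finset ℕ}
    (hT : T ⊆ Finset.range (m - 1)) :
    Set.BijOn (fun P : Finset ℕ × Finset ℕ => BFset m i P.1 P.2)
      {P | S ⊆ P.1 ∧ P.1 ⊆ Finset.range (n - 1) ∧ T ⊆ P.2 ∧ P.2 ⊆ Finset.range (m - 1)}
      {R | BFset m i S T ⊆ R ∧ R ⊆ Finset.range (n + m - 2)} := by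
  refine ⟨?_, ?_, ?_⟩
  · rintro ⟨S', T'⟩ ⟨h₁, h₂, h₃, h₄⟩
    exact ⟨BFset_mono h₁ h₃, BFset_subset_range hm hi h₂ h₄⟩
  · rintro ⟨S₁, T₁⟩ ⟨-, -, -, h₁⟩ ⟨S₂, T₂⟩ ⟨-, -, -, h₂⟩ h
    have h₁₂ := subset_of_BFset_subset h₁ h₂ (subset_of_eq h)
    have h₂₁ := subset_of_BFset_subset h₂ h₁ (subset_of_eq h.symm)
    exact Prod.ext (h₁₂.1.antisymm h₂₁.1) (h₁₂.2.antisymm h₂₁.2)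
  · rintro R ⟨h, hR⟩
    obtain ⟨S', hS', T', hT', rfl⟩ := exists_BFset_eq hm hi hR
    have := subset_of_BFset_subset hT hT' h
    exact ⟨(S', T'), ⟨this.1, hS', this.2, hT'⟩, rfl⟩

theorem BFset_sdiff {m i : ℕ} {S S' T T' : Finset ℕ} (hT : T ⊆ Finset.range (m - 1))
    (hT' : T' ⊆ Finset.range (m - 1)) :
    BFset m i S' T' \ BFset m i S T = BFset m i (S' \ S) (T' \ T) := by
  have hd : T' \ T ⊆ Finset.range (m - 1) := Finset.sdiff_subset.trans hT'
  ext x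
  rw [Finset.mem_sdiff]
  rcases lt_or_ge x i with h | h
  · simp only [mem_BFset_of_lt h, Finset.mem_sdiff]
  rcases lt_or_ge x (i + (m - 1)) with h' | h'
  · obtain ⟨y, rfl⟩ := Nat.exists_eq_add_of_le' h
    have hy : y < m - 1 := by omega
    simp only [add_mem_BFset hy, Finset.mem_sdiff]
  · obtain ⟨y, rfl⟩ := Nat.exists_eq_add_of_le' (le_of_add_le_right h')
    have hy : i ≤ y := by omega
    simp only [add_sub_one_mem_BFset hT hy, add_sub_one_mem_BFset hT' hy,
      add_sub_one_mem_BFset hd hy, Finset.mem_sdiff]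

theorem card_BFset {m i : ℕ} {S T : Finset ℕ} (hT : T ⊆ Finset.range (m - 1)) :
    (BFset m i S T).card = S.card + T.card := by
  rw [BFset, Finset.card_union_of_disjoint, Finset.card_union_of_disjoint,
    Finset.card_image_of_injective _ (add_left_injective _),
    Finset.card_image_of_injective _ (add_left_injective _),
    ← Finset.card_filter_add_card_filter_not (s := S) (fun p => p < i)]
  · simp only [not_lt]
    ring
  · rw [Finset.disjoint_left]
    intro x hx hx'
    simp only [Finset.mem_filter, Finset.mem_image] at hx hx'
    omega
  · rw [Finset.disjoint_left]
    intro x hx hx'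
    obtain ⟨y, hy, rfl⟩ := Finset.mem_image.mp hx'
    have hyi := (Finset.mem_filter.mp hy).2
    rcases Finset.mem_union.mp hx with h | h
    · have := (Finset.mem_filter.mp h).2
      omega
    · obtain ⟨z, hz, hzy⟩ := Finset.mem_image.mp h
      have := Finset.mem_range.mp (hT hz)
      omega

theorem circQ_sum_smul_single {m i : ℕ} (A B : Finset (Finset ℕ)) (c d : Finset ℕ → ℤ) :
    circQ m i (∑ S ∈ A, c S • Finsupp.single S 1) (∑ T ∈ B, d T • Finsupp.single T 1) =
      ∑ P ∈ A ×ˢ B, (c P.1 * d P.2) • Finsupp.single (BFset m i P.1 P.2) (1 : ℤ) := by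
  rw [circQ, ← Finsupp.sum_finsetSum_index (by simp)
    (by simp only [add_mul, add_smul, Finsupp.sum_add, implies_true]), Finset.sum_product]
  refine Finset.sum_congr rfl fun S _ => ?_
  rw [Finsupp.smul_single, Finsupp.sum_single_index (by simp),
    ← Finsupp.sum_finsetSum_index (by simp) (by simp only [mul_add, add_smul, implies_true])]
  refine Finset.sum_congr rfl fun T _ => ?_
  rw [Finsupp.smul_single, Finsupp.sum_single_index (by simp)]
  simp

theorem circQ_Mq {n m i : ℕ} (hm : 1 ≤ m) (hi : i < n) {S T : Finset ℕ}
    (hT : T ⊆ Finset.range (m - 1)) :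
    circQ m i (Mq n S) (Mq m T) = Mq (n + m - 1) (BFset m i S T) := by
  obtain ⟨hmaps, hinj, hsurj⟩ := bijOn_BFset (S := S) hm hi hT
  have hnm : n + m - 1 - 1 = n + m - 2 := by omega
  rw [Mq, Mq, Mq, hnm, circQ_sum_smul_single]
  have hdom : ∀ P : Finset ℕ × Finset ℕ,
      P ∈ (Finset.range (n - 1)).powerset.filter (fun S' => S ⊆ S') ×ˢ
        (Finset.range (m - 1)).powerset.filter (fun T' => T ⊆ T') ↔
      S ⊆ P.1 ∧ P.1 ⊆ Finset.range (n - 1) ∧ T ⊆ P.2 ∧ P.2 ⊆ Finset.range (m - 1) := by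
    intro P
    simp only [Finset.mem_product, Finset.mem_filter, Finset.mem_powerset]
    tauto
  refine Finset.sum_bij (fun P _ => BFset m i P.1 P.2) ?_ ?_ ?_ ?_
  · intro P hP
    have := hmaps ((hdom P).mp hP)
    exact Finset.mem_filter.mpr ⟨Finset.mem_powerset.mpr this.2, this.1⟩
  · exact fun P hP Q hQ h => hinj ((hdom P).mp hP) ((hdom Q).mp hQ) h
  · intro R hR
    obtain ⟨hR₁, hR₂⟩ := Finset.mem_filter.mp hR
    obtain ⟨P, hP, hPR⟩ := hsurj ⟨hR₂, Finset.mem_powerset.mp hR₁⟩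
    exact ⟨P, (hdom P).mpr hP, hPR⟩
  · intro P hP
    obtain ⟨-, -, -, hP₂⟩ := (hdom P).mp hP
    rw [BFset_sdiff hT hP₂, card_BFset (Finset.sdiff_subset.trans hP₂), pow_add]

/-- **Proposition.** `M_S ∘_i M_T = M_{B_i(S,T)}` in `ℤQ_{n+m-1}`; equivalently, `B_i`
restricts to a bijection from `{(S',T') : S ⊆ S' ⊆ [n-1], T ⊆ T' ⊆ [m-1]}` onto
`{R : B_i(S,T) ⊆ R ⊆ [n+m-2]}`. -/
theorem operad_M_Q {n m : ℕ} (hn : 1 ≤ n) (hm : 1 ≤ m) (i : ℕ) (hi : i < n)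
    (S T : Finset ℕ) (hS : S ⊆ Finset.range (n - 1)) (hT : T ⊆ Finset.range (m - 1)) :
    circQ m i (Mq n S) (Mq m T) = Mq (n + m - 1) (BFset m i S T) ∧
    Set.BijOn (fun P : Finset ℕ × Finset ℕ => BFset m i P.1 P.2)
      {P | S ⊆ P.1 ∧ P.1 ⊆ Finset.range (n - 1) ∧ T ⊆ P.2 ∧ P.2 ⊆ Finset.range (m - 1)}
      {R | BFset m i S T ⊆ R ∧ R ⊆ Finset.range (n + m - 2)} := by
  exact ⟨circQ_Mq hm hi hT, bijOn_BFset hm hi hT⟩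
end
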